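/- There exists a constant c_p > 0 depending only on p such that if ψ̂(0) ≥ c_p·‖ψ‖₂, then there exist constants D > 0 and ξ > 0 such that for every integer n with |n| ≥ 2 and every t ∈ (T/2, T): |k̂(n,t)| ≤ D·e^{−ξ|n|}·(T−t)^{(3p−2)/(p+1)}. -/

import Mathlib

open Real MeasureTheory Filter Set

/-- The `n`-th Fourier coefficient of a `2π`-periodic function `f : ℝ → ℝ`:
`f̂(n) = (1/2π) ∫₀^{2π} f(θ) e^{-inθ} dθ`. -/
noncomputable def fCoeff (f : ℝ → ℝ) (n : ℤ) : ℂ :=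
  (1 / (2 * Real.pi)) * ∫ θ in (0:ℝ)..(2 * Real.pi),
    (f θ : ℂ) * Complex.exp (-(Complex.I * n * θ))

/-- The seminorm `‖f‖₂ = max{sup_n n²|Re f̂(n)|, sup_n n²|Im f̂(n)|}`. -/
noncomputable def seminorm2 (f : ℝ → ℝ) : ℝ :=
  max (⨆ n : ℤ, (n : ℝ)^2 * |(fCoeff f n).re|)
      (⨆ n : ℤ, (n : ℝ)^2 * |(fCoeff f n).im|)

/-- The `C^l[0,2π]` norm: `max_{0 ≤ j ≤ l} sup_{θ ∈ [0,2π]} |f^{(j)}(θ)|`. -/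
noncomputable def ClNorm (l : ℕ) (f : ℝ → ℝ) : ℝ :=
  ⨆ j : Fin (l + 1), ⨆ θ : Set.Icc (0:ℝ) (2 * Real.pi),
    |iteratedDeriv (j : ℕ) f (θ : ℝ)|

/-- `k : ℝ × [0,T) → ℝ` is a smooth, `2π`-periodic (in space), strictly positive solution of the
`p`-curve shortening equation
`∂k/∂t = k²(k^{p-1} ∂²k/∂θ² + (p-1) k^{p-2} (∂k/∂θ)² + (1/p) k^p)`
with initial datum `ψ` (smooth, strictly positive, `2π`-periodic), blow-up time `T`
(i.e. `sup_θ k(θ,t) → ∞` as `t → T⁻`), such that `k(·,t)` is the curvature of a simple closed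
convex curve for each `t`, i.e. `∫₀^{2π} e^{iθ}/k(θ,t) dθ = 0`. -/
def IsPCSF (p : ℕ) (T : ℝ) (k : ℝ → ℝ → ℝ) (ψ : ℝ → ℝ) : Prop :=
  ContDiffOn ℝ (⊤ : ℕ∞) (fun q : ℝ × ℝ => k q.1 q.2) (Set.univ ×ˢ Set.Ico 0 T) ∧
  (∀ θ t, k (θ + 2 * Real.pi) t = k θ t) ∧
  (∀ θ : ℝ, ∀ t ∈ Set.Ico (0:ℝ) T, 0 < k θ t) ∧
  (∀ θ : ℝ, ∀ t ∈ Set.Ico (0:ℝ) T,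
    HasDerivAt (fun s => k θ s)
      ((k θ t)^2 * ((k θ t)^(p - 1) * deriv (deriv (fun x => k x t)) θ
        + ((p : ℝ) - 1) * (k θ t)^(p - 2) * (deriv (fun x => k x t) θ)^2
        + (1 / (p : ℝ)) * (k θ t)^p)) t) ∧
  (∀ θ, k θ 0 = ψ θ) ∧
  ContDiff ℝ (⊤ : ℕ∞) ψ ∧ (∀ θ, 0 < ψ θ) ∧ (∀ θ, ψ (θ + 2 * Real.pi) = ψ θ) ∧
  Filter.Tendsto (fun t => ⨆ θ : Set.Icc (0:ℝ) (2 * Real.pi), k (θ : ℝ) t)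
    (nhdsWithin T (Set.Iio T)) Filter.atTop ∧
  (∀ t ∈ Set.Ico (0:ℝ) T,
    (∫ θ in (0:ℝ)..(2 * Real.pi), Complex.exp (Complex.I * θ) / (k θ t)) = 0)

/-- The original time `t` corresponding to the rescaled time `τ`:
`t = T(1 - e^{-(p+1)τ})`, i.e. `τ = -(1/(p+1))·log(1 - t/T)`. -/
noncomputable def tOf (p : ℕ) (T τ : ℝ) : ℝ := T * (1 - Real.exp (-((p : ℝ) + 1) * τ))

/-- The normalized curvature `k̃(θ,τ) = ((p+1)/p)^{1/(p+1)} (T-t)^{1/(p+1)} k(θ,t)`,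
with `t = T(1 - e^{-(p+1)τ})`. -/
noncomputable def ktilde (p : ℕ) (T : ℝ) (k : ℝ → ℝ → ℝ) (θ τ : ℝ) : ℝ :=
  (((p : ℝ) + 1) / (p : ℝ)) ^ ((1 : ℝ) / ((p : ℝ) + 1))
    * (T - tOf p T τ) ^ ((1 : ℝ) / ((p : ℝ) + 1)) * k θ (tOf p T τ)

/-! ### Smooth periodic functions and their Fourier coefficients -/

/-- Smooth `2π`-periodic real functions. -/
structure SmoothPer (f : ℝ → ℝ) : Prop where
  smooth : ContDiff ℝ (⊤ : ℕ∞) f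
  per : Function.Periodic f (2 * Real.pi)

namespace SmoothPer

variable {f g : ℝ → ℝ}

theorem const (c : ℝ) : SmoothPer (fun _ => c) := ⟨contDiff_const, fun _ => rfl⟩

theorem add (hf : SmoothPer f) (hg : SmoothPer g) : SmoothPer (fun x => f x + g x) :=
  ⟨hf.smooth.add hg.smooth, fun x => by simp only [hf.per x, hg.per x]⟩

theorem sub (hf : SmoothPer f) (hg : SmoothPer g) : SmoothPer (fun x => f x - g x) :=
  ⟨hf.smooth.sub hg.smooth, fun x => by simp only [hf.per x, hg.per x]⟩

theorem mul (hf : SmoothPer f) (hg : SmoothPer g) : SmoothPer (fun x => f x * g x) :=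
  ⟨hf.smooth.mul hg.smooth, fun x => by simp only [hf.per x, hg.per x]⟩

theorem pow (hf : SmoothPer f) (m : ℕ) : SmoothPer (fun x => f x ^ m) :=
  ⟨hf.smooth.pow m, fun x => by simp only [hf.per x]⟩

theorem const_mul (c : ℝ) (hf : SmoothPer f) : SmoothPer (fun x => c * f x) :=
  (const c).mul hf

theorem deriv (hf : SmoothPer f) : SmoothPer (deriv f) := by
  refine ⟨(contDiff_infty_iff_deriv.1 hf.smooth).2, fun x => ?_⟩
  rw [← deriv_comp_add_const]
  exact congrFun (congrArg _root_.deriv (funext hf.per)) x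

theorem hasDerivAt (hf : SmoothPer f) (x : ℝ) : HasDerivAt f (_root_.deriv f x) x :=
  (hf.smooth.differentiable (by simp) x).hasDerivAt

theorem continuous (hf : SmoothPer f) : Continuous f := hf.smooth.continuous

end SmoothPer

/-- The Fourier mode `e^{-inθ}` used in `fCoeff`. -/
theorem continuous_fourier_mode (n : ℤ) :
    Continuous (fun θ : ℝ => Complex.exp (-(Complex.I * n * θ))) := by fun_prop

theorem norm_fourier_mode (n : ℤ) (θ : ℝ) : ‖Complex.exp (-(Complex.I * n * θ))‖ = 1 := by
  have : -(Complex.I * n * θ) = ((-(n * θ) : ℝ) : ℂ) * Complex.I := by push_cast; ring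
  rw [this, Complex.norm_exp_ofReal_mul_I]

theorem intervalIntegrable_mode {f : ℝ → ℝ} (hf : Continuous f) (n : ℤ) (a b : ℝ) :
    IntervalIntegrable (fun θ : ℝ => (f θ : ℂ) * Complex.exp (-(Complex.I * n * θ))) volume a b :=
  ((Complex.continuous_ofReal.comp hf).mul (continuous_fourier_mode n)).intervalIntegrable _ _

theorem fCoeff_add {f g : ℝ → ℝ} (hf : Continuous f) (hg : Continuous g) (n : ℤ) :
    fCoeff (fun x => f x + g x) n = fCoeff f n + fCoeff g n := by
  unfold fCoeff
  rw [← mul_add, ← intervalIntegral.integral_add (intervalIntegrable_mode hf n _ _)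
    (intervalIntegrable_mode hg n _ _)]
  simp only [Complex.ofReal_add, add_mul]

theorem fCoeff_const_mul (c : ℝ) (f : ℝ → ℝ) (n : ℤ) :
    fCoeff (fun x => c * f x) n = c * fCoeff f n := by
  unfold fCoeff
  simp only [Complex.ofReal_mul, mul_assoc, intervalIntegral.integral_const_mul]
  ring

theorem fCoeff_sub {f g : ℝ → ℝ} (hf : Continuous f) (hg : Continuous g) (n : ℤ) :
    fCoeff (fun x => f x - g x) n = fCoeff f n - fCoeff g n := by
  have hg' : Continuous fun x => (-1 : ℝ) * g x := continuous_const.mul hg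
  have := fCoeff_add hf hg' n
  rw [fCoeff_const_mul] at this
  simpa [sub_eq_add_neg] using this

theorem norm_fCoeff_le {f : ℝ → ℝ} {C : ℝ} (h : ∀ θ ∈ Icc (0 : ℝ) (2 * Real.pi), |f θ| ≤ C)
    (n : ℤ) : ‖fCoeff f n‖ ≤ C := by
  have hpi := Real.pi_pos
  unfold fCoeff
  have h1 : ‖∫ θ in (0:ℝ)..(2 * Real.pi), (f θ : ℂ) * Complex.exp (-(Complex.I * n * θ))‖
      ≤ C * |2 * Real.pi - 0| := by
    refine intervalIntegral.norm_integral_le_of_norm_le_const fun θ hθ => ?_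
    rw [uIoc_of_le (by positivity)] at hθ
    rw [norm_mul, norm_fourier_mode, mul_one, Complex.norm_real]
    exact h θ ⟨hθ.1.le, hθ.2⟩
  have h2 : ‖(1 / (2 * (Real.pi : ℂ)))‖ = 1 / (2 * Real.pi) := by
    rw [norm_div, norm_mul, Complex.norm_real]
    simp [abs_of_pos hpi]
  rw [norm_mul, h2]
  rw [sub_zero, abs_of_pos (by positivity)] at h1
  calc _ ≤ 1 / (2 * Real.pi) * (C * (2 * Real.pi)) := by gcongr
    _ = C := by field_simp

theorem integral_fourier_mode (n : ℤ) (hn : n ≠ 0) :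
    ∫ θ in (0:ℝ)..(2 * Real.pi), Complex.exp (-(Complex.I * n * θ)) = 0 := by
  have hc : -(Complex.I * n) ≠ 0 := by simp [hn]
  have := integral_exp_mul_complex (a := 0) (b := 2 * Real.pi) hc
  simp only [neg_mul] at this
  rw [this]
  have h2 : Complex.exp (-(Complex.I * n * ((2 * Real.pi : ℝ) : ℂ))) = 1 := by
    rw [Complex.exp_eq_one_iff]
    exact ⟨-n, by push_cast; ring⟩
  rw [h2]
  simp

theorem fCoeff_one (n : ℤ) : fCoeff (fun _ => 1) n = if n = 0 then 1 else 0 := by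
  unfold fCoeff
  split_ifs with h
  · subst h
    have : (Real.pi : ℂ) ≠ 0 := by exact_mod_cast Real.pi_ne_zero
    simp only [Complex.ofReal_one, Int.cast_zero, mul_zero, zero_mul, neg_zero, Complex.exp_zero,
      mul_one, intervalIntegral.integral_const, sub_zero, Complex.real_smul]
    push_cast
    field_simp
  · simp only [Complex.ofReal_one, one_mul]
    rw [integral_fourier_mode n h, mul_zero]

theorem fCoeff_deriv {f : ℝ → ℝ} (hf : SmoothPer f) (n : ℤ) :
    fCoeff (deriv f) n = Complex.I * n * fCoeff f n := by
  have hd : ∀ θ : ℝ, HasDerivAt (fun θ : ℝ => (f θ : ℂ) * Complex.exp (-(Complex.I * n * θ)))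
      (((deriv f θ : ℝ) : ℂ) * Complex.exp (-(Complex.I * n * θ))
        - Complex.I * n * ((f θ : ℂ) * Complex.exp (-(Complex.I * n * θ)))) θ := by
    intro θ
    have h1 : HasDerivAt (fun θ : ℝ => (f θ : ℂ)) ((deriv f θ : ℝ) : ℂ) θ := (hf.hasDerivAt θ).ofReal_comp
    have h2 : HasDerivAt (fun θ : ℝ => -(Complex.I * n * (θ : ℂ))) (-(Complex.I * n * 1)) θ :=
      ((hasDerivAt_id θ).ofReal_comp.const_mul (Complex.I * n)).neg
    exact (h1.mul h2.cexp).congr_deriv (by ring)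
  have hi1 := intervalIntegrable_mode hf.deriv.continuous n 0 (2 * Real.pi)
  have hi2 := (intervalIntegrable_mode hf.continuous n 0 (2 * Real.pi)).const_mul (Complex.I * n)
  have key := intervalIntegral.integral_eq_sub_of_hasDerivAt (fun θ _ => hd θ) (hi1.sub hi2)
  rw [intervalIntegral.integral_sub hi1 hi2, intervalIntegral.integral_const_mul] at key
  have h2 : Complex.exp (-(Complex.I * n * ((2 * Real.pi : ℝ) : ℂ))) = 1 := by
    rw [Complex.exp_eq_one_iff]
    exact ⟨-n, by push_cast; ring⟩
  have hp : f (2 * Real.pi) = f 0 := by simpa using hf.per 0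
  rw [h2, hp] at key
  simp only [Complex.ofReal_zero, mul_zero, neg_zero, Complex.exp_zero, sub_self] at key
  unfold fCoeff
  rw [sub_eq_zero.1 key]
  ring

theorem fCoeff_deriv_deriv {f : ℝ → ℝ} (hf : SmoothPer f) (n : ℤ) :
    fCoeff (deriv (deriv f)) n = -(n : ℂ) ^ 2 * fCoeff f n := by
  rw [fCoeff_deriv hf.deriv, fCoeff_deriv hf]
  linear_combination ((n : ℂ) ^ 2 * fCoeff f n) * Complex.I_sq

/-- Four derivatives control the Fourier coefficients with quartic decay. -/
theorem norm_fCoeff_le_of_deriv_four {f : ℝ → ℝ} (hf : SmoothPer f) {C₀ C₄ : ℝ}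
    (h0 : ∀ θ ∈ Icc (0 : ℝ) (2 * Real.pi), |f θ| ≤ C₀)
    (h4 : ∀ θ ∈ Icc (0 : ℝ) (2 * Real.pi), |deriv (deriv (deriv (deriv f))) θ| ≤ C₄) (n : ℤ) :
    ‖fCoeff f n‖ ≤ (C₀ + C₄) * (1 / (1 + (n : ℝ) ^ 4)) := by
  have a := norm_fCoeff_le h0 n
  have b := norm_fCoeff_le h4 n
  rw [fCoeff_deriv_deriv hf.deriv.deriv, fCoeff_deriv_deriv hf, norm_mul, norm_mul] at b
  have c : ‖-(n : ℂ) ^ 2‖ = (n : ℝ) ^ 2 := by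
    rw [norm_neg, norm_pow, Complex.norm_intCast, sq_abs]
  rw [c] at b
  rw [mul_one_div, le_div_iff₀ (by positivity)]
  nlinarith

theorem exists_bound_of_continuous {f : ℝ → ℝ} (hf : Continuous f) :
    ∃ C, ∀ θ ∈ Icc (0 : ℝ) (2 * Real.pi), |f θ| ≤ C :=
  (isCompact_Icc).exists_bound_of_continuousOn hf.continuousOn

theorem SmoothPer.exists_decay {f : ℝ → ℝ} (hf : SmoothPer f) :
    ∃ C, 0 ≤ C ∧ ∀ n : ℤ, ‖fCoeff f n‖ ≤ C * (1 / (1 + (n : ℝ) ^ 4)) := by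
  obtain ⟨C₀, h0⟩ := exists_bound_of_continuous hf.continuous
  obtain ⟨C₄, h4⟩ := exists_bound_of_continuous hf.deriv.deriv.deriv.deriv.continuous
  have hz : (0 : ℝ) ∈ Icc (0 : ℝ) (2 * Real.pi) := ⟨le_rfl, by positivity⟩
  exact ⟨C₀ + C₄, add_nonneg ((abs_nonneg _).trans (h0 0 hz)) ((abs_nonneg _).trans (h4 0 hz)),
    norm_fCoeff_le_of_deriv_four hf h0 h4⟩

theorem summable_int_quartic : Summable (fun n : ℤ => (1 + (n : ℝ) ^ 2) * (1 / (1 + (n : ℝ) ^ 4))) := by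
  have h1 : Summable (fun n : ℤ => 1 / (n : ℝ) ^ 2) := Real.summable_one_div_int_pow.2 (by norm_num)
  have h2 : Summable (fun n : ℤ => 2 * (1 / (n : ℝ) ^ 2) + if n = 0 then 1 else 0) := by
    refine (h1.mul_left 2).add (summable_of_ne_finset_zero (s := {0}) fun b hb => ?_)
    simpa using hb
  refine Summable.of_nonneg_of_le (fun n => by positivity) (fun n => ?_) h2
  by_cases hn : n = 0
  · simp [hn]
  · have : (1 : ℝ) ≤ (n : ℝ) ^ 2 := by
      have : (1 : ℤ) ≤ n ^ 2 := by have := sq_pos_of_ne_zero hn; omega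
      exact_mod_cast this
    simp only [hn, if_false, add_zero]
    rw [mul_one_div, mul_one_div, div_le_div_iff₀ (by positivity) (by positivity)]
    nlinarith [sq_nonneg ((n : ℝ) ^ 2)]

theorem SmoothPer.summable_fCoeff {f : ℝ → ℝ} (hf : SmoothPer f) :
    Summable (fun n : ℤ => ‖fCoeff f n‖) := by
  obtain ⟨C, hC, h⟩ := hf.exists_decay
  refine Summable.of_nonneg_of_le (fun n => norm_nonneg _) (fun n => (h n).trans ?_)
    (summable_int_quartic.mul_left C)
  have : 0 ≤ 1 / (1 + (n : ℝ) ^ 4) := by positivity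
  gcongr
  nlinarith [mul_nonneg (sq_nonneg (n : ℝ)) this]

theorem SmoothPer.hasSum_fourier {f : ℝ → ℝ} (hf : SmoothPer f) (θ : ℝ) :
    HasSum (fun n : ℤ => fCoeff f n * Complex.exp (Complex.I * n * θ)) (f θ : ℂ) := by
  have : Fact (0 < 2 * Real.pi) := ⟨by positivity⟩
  have hper : Function.Periodic (fun x => (f x : ℂ)) (2 * Real.pi) := fun x => by
    simp only [hf.per x]
  let F : C(AddCircle (2 * Real.pi), ℂ) :=
    ⟨hper.lift, continuous_coinduced_dom.2 (Complex.continuous_ofReal.comp hf.continuous)⟩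
  have hF : ∀ x : ℝ, F (x : AddCircle (2 * Real.pi)) = (f x : ℂ) := fun x => hper.lift_coe x
  have hco : ∀ n, fourierCoeff F n = fCoeff f n := by
    intro n
    rw [fourierCoeff_eq_intervalIntegral F n 0]
    unfold fCoeff
    rw [zero_add, Complex.real_smul]
    congr 1
    · push_cast; rfl
    · refine intervalIntegral.integral_congr fun x _ => ?_
      simp only [hF, fourier_coe_apply, smul_eq_mul]
      rw [mul_comm]
      congr 2
      have : (Real.pi : ℂ) ≠ 0 := by exact_mod_cast Real.pi_ne_zero
      push_cast
      field_simp
  have hs : Summable (fourierCoeff F) := by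
    rw [funext hco]; exact hf.summable_fCoeff.of_norm
  have := has_pointwise_sum_fourier_series_of_summable hs (θ : AddCircle (2 * Real.pi))
  rw [hF] at this
  convert this using 1
  funext n
  rw [hco, smul_eq_mul, fourier_coe_apply]
  congr 2
  have : (Real.pi : ℂ) ≠ 0 := by exact_mod_cast Real.pi_ne_zero
  push_cast
  field_simp

theorem HasSum.of_eq {f g : ℤ → ℂ} {a : ℂ} (h : HasSum g a) (e : ∀ j, f j = g j) : HasSum f a := by
  rwa [show f = g from funext e]

theorem hasSum_fCoeff_mul {f g : ℝ → ℝ} (hf : SmoothPer f) (hg : SmoothPer g) (n : ℤ) :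
    HasSum (fun j : ℤ => fCoeff f j * fCoeff g (n - j)) (fCoeff (fun x => f x * g x) n) := by
  have hsplit : ∀ (j : ℤ) (θ : ℝ), Complex.exp (Complex.I * j * θ)
      * Complex.exp (-(Complex.I * n * θ)) = Complex.exp (-(Complex.I * ((n - j : ℤ) : ℂ) * θ)) := by
    intro j θ
    rw [← Complex.exp_add]
    congr 1
    push_cast
    ring
  have key := intervalIntegral.hasSum_integral_of_dominated_convergence (μ := volume)
    (a := 0) (b := 2 * Real.pi)
    (F := fun (j : ℤ) (θ : ℝ) => fCoeff f j * ((g θ : ℂ) *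
      Complex.exp (-(Complex.I * ((n - j : ℤ) : ℂ) * θ))))
    (f := fun θ => ((f θ * g θ : ℝ) : ℂ) * Complex.exp (-(Complex.I * n * θ)))
    (fun j θ => ‖fCoeff f j‖ * |g θ|) ?_ ?_ ?_ ?_ ?_
  · have := key.mul_left (1 / (2 * (Real.pi : ℂ)))
    refine HasSum.of_eq this fun j => ?_
    rw [intervalIntegral.integral_const_mul]
    simp only [fCoeff]
    ring
  · intro j
    exact (((Complex.continuous_ofReal.comp hg.continuous).mul
      (continuous_fourier_mode _)).const_mul _).aestronglyMeasurable
  · intro j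
    refine ae_of_all _ fun θ _ => ?_
    rw [norm_mul, norm_mul, norm_fourier_mode, mul_one, Complex.norm_real, Real.norm_eq_abs]
  · exact ae_of_all _ fun θ _ => hf.summable_fCoeff.mul_right _
  · simp only [tsum_mul_right]
    exact (continuous_const.mul hg.continuous.abs).intervalIntegrable _ _
  · refine ae_of_all _ fun θ _ => ?_
    have := (hf.hasSum_fourier θ).mul_right ((g θ : ℂ) * Complex.exp (-(Complex.I * n * θ)))
    have e : ((f θ * g θ : ℝ) : ℂ) * Complex.exp (-(Complex.I * n * θ))
        = f θ * ((g θ : ℂ) * Complex.exp (-(Complex.I * n * θ))) := by push_cast; ring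
    rw [e]
    refine HasSum.of_eq this fun j => ?_
    rw [← hsplit]
    ring

/-! ### Weighted Wiener norms -/

/-- Bounded submultiplicative weights on `ℤ`. -/
structure IsWeight (ω : ℤ → ℝ) : Prop where
  one_le : ∀ n, 1 ≤ ω n
  mul_le : ∀ m n, ω (m + n) ≤ ω m * ω n
  bdd : ∃ B, ∀ n, ω n ≤ B

/-- The weighted Wiener norm `∑ ω(n) |f̂(n)|`. -/
noncomputable def wnorm (ω : ℤ → ℝ) (f : ℝ → ℝ) : ℝ := ∑' n : ℤ, ω n * ‖fCoeff f n‖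

/-- The weighted Wiener norm of the second derivative, `∑ n² ω(n) |f̂(n)|`. -/
noncomputable def wnorm2 (ω : ℤ → ℝ) (f : ℝ → ℝ) : ℝ :=
  ∑' n : ℤ, (n : ℝ) ^ 2 * (ω n * ‖fCoeff f n‖)

section Wiener

variable {ω : ℤ → ℝ} {f g : ℝ → ℝ}

theorem IsWeight.pos (hω : IsWeight ω) (n : ℤ) : 0 < ω n := one_pos.trans_le (hω.one_le n)

theorem IsWeight.summable_aux (hω : IsWeight ω) (hf : SmoothPer f) :
    Summable (fun n : ℤ => (1 + (n : ℝ) ^ 2) * (ω n * ‖fCoeff f n‖)) := by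
  obtain ⟨C, hC, h⟩ := hf.exists_decay
  obtain ⟨B, hB⟩ := hω.bdd
  have hB0 : 0 ≤ B := (hω.pos 0).le.trans (hB 0)
  refine Summable.of_nonneg_of_le (fun n => ?_) (fun n => ?_) (summable_int_quartic.mul_left (B * C))
  · have := hω.pos n
    positivity
  · calc (1 + (n : ℝ) ^ 2) * (ω n * ‖fCoeff f n‖)
        ≤ (1 + (n : ℝ) ^ 2) * (B * (C * (1 / (1 + (n : ℝ) ^ 4)))) := by
          gcongr
          · exact hB n
          · exact h n
      _ = _ := by ring

theorem IsWeight.summable (hω : IsWeight ω) (hf : SmoothPer f) :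
    Summable (fun n : ℤ => ω n * ‖fCoeff f n‖) := by
  refine Summable.of_nonneg_of_le (fun n => ?_) (fun n => ?_) (hω.summable_aux hf)
  · have := hω.pos n
    positivity
  · have : 0 ≤ ω n * ‖fCoeff f n‖ := by have := hω.pos n; positivity
    nlinarith [mul_nonneg (sq_nonneg (n : ℝ)) this]

theorem IsWeight.summable2 (hω : IsWeight ω) (hf : SmoothPer f) :
    Summable (fun n : ℤ => (n : ℝ) ^ 2 * (ω n * ‖fCoeff f n‖)) :=
  ((hω.summable_aux hf).sub (hω.summable hf)).congr fun n => by ring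

theorem wnorm_nonneg (hω : IsWeight ω) (f : ℝ → ℝ) : 0 ≤ wnorm ω f :=
  tsum_nonneg fun n => mul_nonneg (hω.pos n).le (norm_nonneg _)

theorem wnorm2_nonneg (hω : IsWeight ω) (f : ℝ → ℝ) : 0 ≤ wnorm2 ω f :=
  tsum_nonneg fun n => mul_nonneg (sq_nonneg _) (mul_nonneg (hω.pos n).le (norm_nonneg _))

theorem weight_mul_norm_fCoeff_le_wnorm (hω : IsWeight ω) (hf : SmoothPer f) (n : ℤ) :
    ω n * ‖fCoeff f n‖ ≤ wnorm ω f :=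
  (hω.summable hf).le_tsum n fun j _ => mul_nonneg (hω.pos j).le (norm_nonneg _)

theorem norm_fCoeff_le_wnorm (hω : IsWeight ω) (hf : SmoothPer f) (n : ℤ) :
    ‖fCoeff f n‖ ≤ wnorm ω f :=
  (le_mul_of_one_le_left (norm_nonneg _) (hω.one_le n)).trans
    (weight_mul_norm_fCoeff_le_wnorm hω hf n)

theorem abs_le_wnorm (hω : IsWeight ω) (hf : SmoothPer f) (θ : ℝ) : |f θ| ≤ wnorm ω f := by
  have h := hf.hasSum_fourier θ
  have hn : ∀ n : ℤ, ‖fCoeff f n * Complex.exp (Complex.I * n * θ)‖ = ‖fCoeff f n‖ := by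
    intro n
    have := norm_fourier_mode (-n) θ
    rw [norm_mul]
    rw [show -(Complex.I * ((-n : ℤ) : ℂ) * θ) = Complex.I * n * θ by push_cast; ring] at this
    rw [this, mul_one]
  calc |f θ| = ‖(f θ : ℂ)‖ := by rw [Complex.norm_real, Real.norm_eq_abs]
    _ = ‖∑' n : ℤ, fCoeff f n * Complex.exp (Complex.I * n * θ)‖ := by rw [h.tsum_eq]
    _ ≤ ∑' n : ℤ, ‖fCoeff f n * Complex.exp (Complex.I * n * θ)‖ :=
        norm_tsum_le_tsum_norm (by simpa only [hn] using hf.summable_fCoeff)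
    _ = ∑' n : ℤ, ‖fCoeff f n‖ := by simp only [hn]
    _ ≤ wnorm ω f := hf.summable_fCoeff.tsum_le_tsum
        (fun n => le_mul_of_one_le_left (norm_nonneg _) (hω.one_le n)) (hω.summable hf)

theorem wnorm_add_le (hω : IsWeight ω) (hf : SmoothPer f) (hg : SmoothPer g) :
    wnorm ω (fun x => f x + g x) ≤ wnorm ω f + wnorm ω g := by
  unfold wnorm
  rw [← (hω.summable hf).tsum_add (hω.summable hg)]
  refine (hω.summable (hf.add hg)).tsum_le_tsum (fun n => ?_)
    ((hω.summable hf).add (hω.summable hg))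
  rw [fCoeff_add hf.continuous hg.continuous, ← mul_add]
  exact mul_le_mul_of_nonneg_left (norm_add_le _ _) (hω.pos n).le

theorem wnorm2_add_le (hω : IsWeight ω) (hf : SmoothPer f) (hg : SmoothPer g) :
    wnorm2 ω (fun x => f x + g x) ≤ wnorm2 ω f + wnorm2 ω g := by
  unfold wnorm2
  rw [← (hω.summable2 hf).tsum_add (hω.summable2 hg)]
  refine (hω.summable2 (hf.add hg)).tsum_le_tsum (fun n => ?_)
    ((hω.summable2 hf).add (hω.summable2 hg))
  rw [fCoeff_add hf.continuous hg.continuous, ← mul_add, ← mul_add]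
  exact mul_le_mul_of_nonneg_left
    (mul_le_mul_of_nonneg_left (norm_add_le _ _) (hω.pos n).le) (sq_nonneg _)

theorem wnorm_const_mul (c : ℝ) : wnorm ω (fun x => c * f x) = |c| * wnorm ω f := by
  unfold wnorm
  rw [← tsum_mul_left]
  refine tsum_congr fun n => ?_
  rw [fCoeff_const_mul, norm_mul, Complex.norm_real, Real.norm_eq_abs]
  ring

theorem wnorm2_const_mul (c : ℝ) : wnorm2 ω (fun x => c * f x) = |c| * wnorm2 ω f := by
  unfold wnorm2
  rw [← tsum_mul_left]
  refine tsum_congr fun n => ?_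
  rw [fCoeff_const_mul, norm_mul, Complex.norm_real, Real.norm_eq_abs]
  ring

theorem hasSum_convolution {a b : ℤ → ℝ} (ha : Summable a) (hb : Summable b)
    (ha0 : ∀ n, 0 ≤ a n) (hb0 : ∀ n, 0 ≤ b n) :
    (∀ n, Summable fun j => a j * b (n - j)) ∧
      HasSum (fun n => ∑' j, a j * b (n - j)) ((∑' n, a n) * ∑' n, b n) := by
  have hp : Summable (fun q : ℤ × ℤ => a q.1 * b q.2) := ha.mul_of_nonneg hb ha0 hb0
  let e : ℤ × ℤ ≃ ℤ × ℤ :=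
    { toFun := fun q => (q.2, q.1 - q.2)
      invFun := fun q => (q.1 + q.2, q.1)
      left_inv := fun q => by simp
      right_inv := fun q => by simp }
  have he : Summable (fun q : ℤ × ℤ => a q.2 * b (q.1 - q.2)) := e.summable_iff.2 hp
  have hs : ∀ n, Summable fun j => a j * b (n - j) := fun n => he.prod_factor n
  refine ⟨hs, ?_⟩
  have h1 : HasSum (fun q : ℤ × ℤ => a q.2 * b (q.1 - q.2)) ((∑' n, a n) * ∑' n, b n) := by
    rw [ha.tsum_mul_tsum hb hp]
    exact e.hasSum_iff.2 hp.hasSum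
  exact h1.prod_fiberwise fun n => (hs n).hasSum

theorem norm_fCoeff_mul_le (hf : SmoothPer f) (hg : SmoothPer g) (n : ℤ) :
    ‖fCoeff (fun x => f x * g x) n‖ ≤ ∑' j : ℤ, ‖fCoeff f j‖ * ‖fCoeff g (n - j)‖ := by
  rw [← (hasSum_fCoeff_mul hf hg n).tsum_eq]
  have := (hasSum_convolution hf.summable_fCoeff hg.summable_fCoeff (fun _ => norm_nonneg _)
    fun _ => norm_nonneg _).1 n
  refine (norm_tsum_le_tsum_norm (by simpa only [norm_mul] using this)).trans_eq ?_
  simp only [norm_mul]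

theorem weight_mul_norm_fCoeff_mul_le (hω : IsWeight ω) (hf : SmoothPer f) (hg : SmoothPer g)
    (n : ℤ) : ω n * ‖fCoeff (fun x => f x * g x) n‖
      ≤ ∑' j : ℤ, (ω j * ‖fCoeff f j‖) * (ω (n - j) * ‖fCoeff g (n - j)‖) := by
  have h0 := (hasSum_convolution hf.summable_fCoeff hg.summable_fCoeff (fun _ => norm_nonneg _)
    fun _ => norm_nonneg _).1 n
  have h1 := (hasSum_convolution (hω.summable hf) (hω.summable hg)
    (fun j => mul_nonneg (hω.pos j).le (norm_nonneg _))
    fun j => mul_nonneg (hω.pos j).le (norm_nonneg _)).1 n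
  calc _ ≤ ω n * ∑' j : ℤ, ‖fCoeff f j‖ * ‖fCoeff g (n - j)‖ :=
        mul_le_mul_of_nonneg_left (norm_fCoeff_mul_le hf hg n) (hω.pos n).le
    _ = ∑' j : ℤ, ω n * (‖fCoeff f j‖ * ‖fCoeff g (n - j)‖) := tsum_mul_left.symm
    _ ≤ _ := (h0.mul_left _).tsum_le_tsum (fun j => ?_) h1
  have := hω.mul_le j (n - j)
  rw [add_sub_cancel] at this
  calc _ ≤ (ω j * ω (n - j)) * (‖fCoeff f j‖ * ‖fCoeff g (n - j)‖) := by gcongr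
    _ = _ := by ring

theorem wnorm_mul_le (hω : IsWeight ω) (hf : SmoothPer f) (hg : SmoothPer g) :
    wnorm ω (fun x => f x * g x) ≤ wnorm ω f * wnorm ω g := by
  have h1 := (hasSum_convolution (hω.summable hf) (hω.summable hg)
    (fun j => mul_nonneg (hω.pos j).le (norm_nonneg _))
    fun j => mul_nonneg (hω.pos j).le (norm_nonneg _)).2
  unfold wnorm
  rw [← h1.tsum_eq]
  exact (hω.summable (hf.mul hg)).tsum_le_tsum (weight_mul_norm_fCoeff_mul_le hω hf hg) h1.summable

theorem wnorm2_mul_le (hω : IsWeight ω) (hf : SmoothPer f) (hg : SmoothPer g) :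
    wnorm2 ω (fun x => f x * g x) ≤ 2 * (wnorm2 ω f * wnorm ω g + wnorm ω f * wnorm2 ω g) := by
  have p0 : ∀ (φ : ℝ → ℝ) (j : ℤ), 0 ≤ ω j * ‖fCoeff φ j‖ :=
    fun φ j => mul_nonneg (hω.pos j).le (norm_nonneg _)
  have p2 : ∀ (φ : ℝ → ℝ) (j : ℤ), 0 ≤ (j : ℝ) ^ 2 * (ω j * ‖fCoeff φ j‖) :=
    fun φ j => mul_nonneg (sq_nonneg _) (p0 φ j)
  obtain ⟨s0, -⟩ := hasSum_convolution (hω.summable hf) (hω.summable hg) (p0 f) (p0 g)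
  obtain ⟨s1, h1⟩ := hasSum_convolution (hω.summable2 hf) (hω.summable hg) (p2 f) (p0 g)
  obtain ⟨s2, h2⟩ := hasSum_convolution (hω.summable hf) (hω.summable2 hg) (p0 f) (p2 g)
  have h3 := (h1.add h2).mul_left 2
  unfold wnorm2 wnorm
  rw [← h3.tsum_eq]
  refine (hω.summable2 (hf.mul hg)).tsum_le_tsum (fun n => ?_) h3.summable
  calc _ ≤ (n : ℝ) ^ 2 * ∑' j : ℤ, (ω j * ‖fCoeff f j‖) * (ω (n - j) * ‖fCoeff g (n - j)‖) :=
        mul_le_mul_of_nonneg_left (weight_mul_norm_fCoeff_mul_le hω hf hg n) (sq_nonneg _)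
    _ = ∑' j : ℤ, (n : ℝ) ^ 2 * ((ω j * ‖fCoeff f j‖) * (ω (n - j) * ‖fCoeff g (n - j)‖)) :=
        tsum_mul_left.symm
    _ ≤ ∑' j : ℤ, 2 * (((j : ℝ) ^ 2 * (ω j * ‖fCoeff f j‖)) * (ω (n - j) * ‖fCoeff g (n - j)‖)
          + (ω j * ‖fCoeff f j‖) * (((n - j : ℤ) : ℝ) ^ 2 * (ω (n - j) * ‖fCoeff g (n - j)‖))) :=
        ((s0 n).mul_left _).tsum_le_tsum (fun j => ?_) (((s1 n).add (s2 n)).mul_left 2)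
    _ = _ := by rw [tsum_mul_left, (s1 n).tsum_add (s2 n)]
  have q := mul_nonneg (p0 f j) (p0 g (n - j))
  push_cast
  nlinarith [mul_nonneg (sq_nonneg ((n : ℝ) - 2 * j)) q]

end Wiener

/-! ### Reciprocals and powers near `1` in the Wiener algebra -/

theorem exists_power_remainder_bound (p : ℕ) :
    ∃ C : ℝ, 0 ≤ C ∧ ∀ (ω : ℤ → ℝ) (u : ℝ → ℝ), IsWeight ω → SmoothPer u → wnorm ω u ≤ 1 →
      wnorm ω (fun x => (1 + u x) ^ p - 1 - p * u x) ≤ C * wnorm ω u ^ 2 ∧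
      wnorm2 ω (fun x => (1 + u x) ^ p - 1 - p * u x) ≤ C * (wnorm ω u * wnorm2 ω u) := by
  induction p with
  | zero =>
    refine ⟨0, le_rfl, fun ω u hω hu h1 => ?_⟩
    have e : (fun x => (1 + u x) ^ 0 - 1 - ((0 : ℕ) : ℝ) * u x) = fun x => (0 : ℝ) * u x := by
      funext x; simp
    rw [e, wnorm_const_mul, wnorm2_const_mul]
    simp
  | succ p ih =>
    obtain ⟨C, hC, h⟩ := ih
    refine ⟨5 * C + 4 * p, by positivity, fun ω u hω hu h1 => ?_⟩
    obtain ⟨i1, i2⟩ := h ω u hω hu h1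
    set H : ℝ → ℝ := fun x => (1 + u x) ^ p - 1 - p * u x with hH
    have sH : SmoothPer H :=
      ((((SmoothPer.const 1).add hu).pow p).sub (SmoothPer.const 1)).sub (hu.const_mul p)
    have e : (fun x => (1 + u x) ^ (p + 1) - 1 - ((p + 1 : ℕ) : ℝ) * u x)
        = fun x => H x + (H x * u x + (p : ℝ) * (u x * u x)) := by
      funext x
      simp only [hH]
      push_cast
      ring
    have n0 := wnorm_nonneg hω u
    have n2 := wnorm2_nonneg hω u
    have m0 := wnorm_nonneg hω H
    have hp : (0 : ℝ) ≤ p := Nat.cast_nonneg p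
    rw [e]
    constructor
    · have a1 := wnorm_add_le hω sH ((sH.mul hu).add ((hu.mul hu).const_mul p))
      have a2 := wnorm_add_le hω (sH.mul hu) ((hu.mul hu).const_mul p)
      rw [wnorm_const_mul, abs_of_nonneg hp] at a2
      have a3 := wnorm_mul_le hω sH hu
      have a4 := mul_le_mul_of_nonneg_left (wnorm_mul_le hω hu hu) hp
      have a5 : wnorm ω H * wnorm ω u ≤ C * wnorm ω u ^ 2 :=
        (mul_le_of_le_one_right m0 h1).trans i1
      nlinarith [mul_nonneg hC (sq_nonneg (wnorm ω u)), mul_nonneg hp (sq_nonneg (wnorm ω u))]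
    · have a1 := wnorm2_add_le hω sH ((sH.mul hu).add ((hu.mul hu).const_mul p))
      have a2 := wnorm2_add_le hω (sH.mul hu) ((hu.mul hu).const_mul p)
      rw [wnorm2_const_mul, abs_of_nonneg hp] at a2
      have a3 := wnorm2_mul_le hω sH hu
      have a4 := mul_le_mul_of_nonneg_left (wnorm2_mul_le hω hu hu) hp
      have q : 0 ≤ wnorm ω u * wnorm2 ω u := mul_nonneg n0 n2
      have a5 : wnorm2 ω H * wnorm ω u ≤ C * (wnorm ω u * wnorm2 ω u) :=
        (mul_le_of_le_one_right (wnorm2_nonneg hω H) h1).trans i2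
      have a6 : wnorm ω H * wnorm2 ω u ≤ C * (wnorm ω u * wnorm2 ω u) := by
        calc _ ≤ C * wnorm ω u ^ 2 * wnorm2 ω u := by gcongr
          _ = wnorm ω u * (C * (wnorm ω u * wnorm2 ω u)) := by ring
          _ ≤ _ := mul_le_of_le_one_left (mul_nonneg hC q) h1
      nlinarith

theorem wnorm_reciprocal_le {ω : ℤ → ℝ} {u w : ℝ → ℝ} (hω : IsWeight ω) (hu : SmoothPer u)
    (hw : SmoothPer w) (huw : ∀ x, (1 + u x) * (1 + w x) = 1) (hsmall : wnorm ω w ≤ 1 / 8) :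
    wnorm ω u ≤ 2 * wnorm ω w ∧ wnorm2 ω u ≤ 2 * wnorm2 ω w := by
  have e : u = fun x => (-1 : ℝ) * w x + (-1 : ℝ) * (u x * w x) := by
    funext x; linarith [huw x]
  have n0 := wnorm_nonneg hω u
  have n2 := wnorm2_nonneg hω u
  have m0 := wnorm_nonneg hω w
  have m2 := wnorm2_nonneg hω w
  have b1 := wnorm_mul_le hω hu hw
  have b2 := wnorm2_mul_le hω hu hw
  have a1 := wnorm_add_le hω (hw.const_mul (-1)) ((hu.mul hw).const_mul (-1))
  have a2 := wnorm2_add_le hω (hw.const_mul (-1)) ((hu.mul hw).const_mul (-1))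
  rw [← e, wnorm_const_mul, wnorm_const_mul, abs_neg, abs_one, one_mul, one_mul] at a1
  rw [← e, wnorm2_const_mul, wnorm2_const_mul, abs_neg, abs_one, one_mul, one_mul] at a2
  have c1 : wnorm ω u ≤ 2 * wnorm ω w := by nlinarith
  refine ⟨c1, ?_⟩
  nlinarith

theorem exists_reciprocal_power_bound (p : ℕ) :
    ∃ C : ℝ, 0 ≤ C ∧ ∀ (ω : ℤ → ℝ) (u w : ℝ → ℝ), IsWeight ω → SmoothPer u → SmoothPer w →
      (∀ x, (1 + u x) * (1 + w x) = 1) → wnorm ω w ≤ 1 / 8 →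
      wnorm ω (fun x => (1 + u x) ^ p - 1 + p * w x) ≤ C * wnorm ω w ^ 2 ∧
      wnorm2 ω (fun x => (1 + u x) ^ p - 1 + p * w x) ≤ C * (wnorm ω w * wnorm2 ω w) := by
  obtain ⟨C, hC, h⟩ := exists_power_remainder_bound p
  refine ⟨4 * C + 8 * p, by positivity, fun ω u w hω hu hw huw hs => ?_⟩
  obtain ⟨r0, r2⟩ := wnorm_reciprocal_le hω hu hw huw hs
  obtain ⟨i1, i2⟩ := h ω u hω hu (by linarith)
  set H : ℝ → ℝ := fun x => (1 + u x) ^ p - 1 - p * u x with hH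
  have sH : SmoothPer H :=
    ((((SmoothPer.const 1).add hu).pow p).sub (SmoothPer.const 1)).sub (hu.const_mul p)
  have e : (fun x => (1 + u x) ^ p - 1 + p * w x) = fun x => H x + (-(p : ℝ)) * (u x * w x) := by
    funext x
    simp only [hH]
    linear_combination (p : ℝ) * huw x
  have hp : (0 : ℝ) ≤ p := Nat.cast_nonneg p
  have n0 := wnorm_nonneg hω u
  have n2 := wnorm2_nonneg hω u
  have m0 := wnorm_nonneg hω w
  have m2 := wnorm2_nonneg hω w
  have b1 := mul_le_mul_of_nonneg_left (wnorm_mul_le hω hu hw) hp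
  have b2 := mul_le_mul_of_nonneg_left (wnorm2_mul_le hω hu hw) hp
  have a1 := wnorm_add_le hω sH ((hu.mul hw).const_mul (-(p : ℝ)))
  have a2 := wnorm2_add_le hω sH ((hu.mul hw).const_mul (-(p : ℝ)))
  rw [wnorm_const_mul, abs_neg, abs_of_nonneg hp] at a1
  rw [wnorm2_const_mul, abs_neg, abs_of_nonneg hp] at a2
  rw [e]
  constructor
  · have c1 : wnorm ω u ^ 2 ≤ (2 * wnorm ω w) ^ 2 := by gcongr
    have c2 : wnorm ω u * wnorm ω w ≤ 2 * wnorm ω w * wnorm ω w := by gcongr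
    nlinarith [mul_le_mul_of_nonneg_left c1 hC, mul_le_mul_of_nonneg_left c2 hp,
      mul_nonneg hp (sq_nonneg (wnorm ω w))]
  · have c1 : wnorm ω u * wnorm2 ω u ≤ (2 * wnorm ω w) * (2 * wnorm2 ω w) := by gcongr
    have c2 : wnorm2 ω u * wnorm ω w ≤ 2 * wnorm2 ω w * wnorm ω w := by gcongr
    have c3 : wnorm ω u * wnorm2 ω w ≤ 2 * wnorm ω w * wnorm2 ω w := by gcongr
    nlinarith [mul_le_mul_of_nonneg_left c1 hC, mul_le_mul_of_nonneg_left c2 hp,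
      mul_le_mul_of_nonneg_left c3 hp]

/-! ### Monotonicity of weighted sums of norms -/

theorem norm_le_add_integral {z z' : ℝ → ℂ} {h : ℝ → ℝ} {a b : ℝ} (hab : a ≤ b)
    (hz : ContinuousOn z (Icc a b)) (hd : ∀ x ∈ Ico a b, HasDerivAt z (z' x) x)
    (hh : ContinuousOn h (Icc a b))
    (h1 : ∀ x ∈ Ico a b, z x ≠ 0 → (inner ℝ (z x) (z' x) : ℝ) ≤ h x * ‖z x‖)
    (h2 : ∀ x ∈ Ico a b, z x = 0 → ‖z' x‖ ≤ h x) :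
    ‖z b‖ ≤ ‖z a‖ + ∫ x in a..b, h x := by
  set H : ℝ → ℝ := IccExtend hab ((Icc a b).domRestrict h) with hH
  have cH : Continuous H := hh.domRestrict.Icc_extend'
  have eH : ∀ x ∈ Icc a b, H x = h x := fun x hx => by
    rw [hH, IccExtend_of_mem _ _ hx]; rfl
  have eint : ∫ x in a..b, h x = ∫ x in a..b, H x :=
    intervalIntegral.integral_congr fun x hx => by
      rw [uIcc_of_le hab] at hx
      exact (eH x hx).symm
  rw [eint]
  have hB : ∀ x, HasDerivAt (fun t => ‖z a‖ + ∫ y in a..t, H y) (H x) x := fun x =>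
    (cH.integral_hasStrictDerivAt a x).hasDerivAt.const_add _
  refine image_le_of_liminf_slope_right_le_deriv_boundary (f := fun t => ‖z t‖)
    (B := fun t => ‖z a‖ + ∫ y in a..t, H y) (B' := H) hz.norm (by simp)
    (fun x _ => (hB x).continuousAt.continuousWithinAt) (fun x _ => (hB x).hasDerivWithinAt)
    (fun x hx r hr => ?_) ⟨hab, le_rfl⟩
  rw [eH x ⟨hx.1, hx.2.le⟩] at hr
  by_cases h0 : z x = 0
  · have := ((hd x hx).hasDerivWithinAt (s := Ici x)).liminf_right_slope_norm_le
      ((h2 x hx h0).trans_lt hr)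
    simpa [slope_def_field, div_eq_inv_mul] using this
  · have hp : 0 < ‖z x‖ := norm_pos_iff.2 h0
    have d1 : HasDerivAt (fun t => ‖z t‖) ((inner ℝ (z x) (z' x) : ℝ) / ‖z x‖) x := by
      have := ((hd x hx).norm_sq).sqrt (by positivity)
      simp only [Real.sqrt_sq (norm_nonneg _)] at this
      exact this.congr_deriv (by field_simp)
    exact (d1.hasDerivWithinAt (s := Ici x)).liminf_right_slope_le
      (((div_le_iff₀ hp).2 (h1 x hx h0)).trans_lt hr)

theorem tsum_norm_le_tsum_norm_of_dini {z z' : ℤ → ℝ → ℂ} {h : ℤ → ℝ → ℝ} {B : ℤ → ℝ} {a b : ℝ}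
    (hab : a ≤ b) (hz : ∀ n, ContinuousOn (z n) (Icc a b))
    (hd : ∀ n, ∀ x ∈ Ico a b, HasDerivAt (z n) (z' n x) x)
    (hh : ∀ n, ContinuousOn (h n) (Icc a b))
    (h1 : ∀ n, ∀ x ∈ Ico a b, z n x ≠ 0 → (inner ℝ (z n x) (z' n x) : ℝ) ≤ h n x * ‖z n x‖)
    (h2 : ∀ n, ∀ x ∈ Ico a b, z n x = 0 → ‖z' n x‖ ≤ h n x)
    (hB : Summable B) (hhB : ∀ n, ∀ x ∈ Icc a b, |h n x| ≤ B n)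
    (hsum : ∀ x ∈ Ioo a b, ∑' n, h n x ≤ 0)
    (sa : Summable fun n => ‖z n a‖) (sb : Summable fun n => ‖z n b‖) :
    ∑' n, ‖z n b‖ ≤ ∑' n, ‖z n a‖ := by
  have key : HasSum (fun n => ∫ x in a..b, h n x) (∫ x in a..b, ∑' n, h n x) := by
    refine intervalIntegral.hasSum_integral_of_dominated_convergence (fun n _ => B n)
      (fun n => ?_) (fun n => ae_of_all _ fun x hx => ?_) (ae_of_all _ fun _ _ => hB)
      (intervalIntegrable_const) (ae_of_all _ fun x hx => ?_)
    · rw [uIoc_of_le hab]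
      exact ((hh n).mono Ioc_subset_Icc_self).aestronglyMeasurable measurableSet_Ioc
    · rw [uIoc_of_le hab] at hx
      exact hhB n x (Ioc_subset_Icc_self hx)
    · rw [uIoc_of_le hab] at hx
      exact (hB.of_norm_bounded (fun n => hhB n x (Ioc_subset_Icc_self hx))).hasSum
  have hneg : ∫ x in a..b, ∑' n, h n x ≤ 0 := by
    by_cases hi : IntervalIntegrable (fun x => ∑' n, h n x) volume a b
    · have := intervalIntegral.integral_mono_on_of_le_Ioo hab hi
        (intervalIntegrable_const (c := (0 : ℝ))) hsum
      simpa using this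
    · rw [intervalIntegral.integral_undef hi]
  have := sb.tsum_le_tsum
    (fun n => norm_le_add_integral hab (hz n) (hd n) (hh n) (h1 n) (h2 n))
    (sa.add key.summable)
  rw [sa.tsum_add key.summable, key.tsum_eq] at this
  linarith

/-! ### Space-time smooth periodic functions -/

/-- Functions on `ℝ × [0,T)`, smooth up to `t = 0` and `2π`-periodic in space. -/
structure SmoothST (T : ℝ) (f : ℝ → ℝ → ℝ) : Prop where
  smooth : ContDiffOn ℝ (⊤ : ℕ∞) (fun q : ℝ × ℝ => f q.1 q.2) (Set.univ ×ˢ Set.Ico 0 T)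
  per : ∀ θ, ∀ t ∈ Ico 0 T, f (θ + 2 * Real.pi) t = f θ t

namespace SmoothST

variable {T : ℝ} {f g : ℝ → ℝ → ℝ}

theorem add (hf : SmoothST T f) (hg : SmoothST T g) : SmoothST T (fun x t => f x t + g x t) :=
  ⟨hf.smooth.add hg.smooth, fun θ t ht => by simp only [hf.per θ t ht, hg.per θ t ht]⟩

theorem pow (hf : SmoothST T f) (m : ℕ) : SmoothST T (fun x t => f x t ^ m) :=
  ⟨hf.smooth.pow m, fun θ t ht => by simp only [hf.per θ t ht]⟩

theorem const_mul (c : ℝ) (hf : SmoothST T f) : SmoothST T (fun x t => c * f x t) :=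
  ⟨contDiffOn_const.mul hf.smooth, fun θ t ht => by simp only [hf.per θ t ht]⟩

theorem inv (hf : SmoothST T f) (h0 : ∀ θ, ∀ t ∈ Ico 0 T, f θ t ≠ 0) :
    SmoothST T (fun x t => (f x t)⁻¹) :=
  ⟨hf.smooth.inv fun q hq => h0 q.1 q.2 hq.2, fun θ t ht => by simp only [hf.per θ t ht]⟩

theorem slice (hf : SmoothST T f) {t : ℝ} (ht : t ∈ Ico 0 T) : SmoothPer (fun x => f x t) := by
  refine ⟨?_, fun x => hf.per x t ht⟩
  have h : ContDiffOn ℝ (⊤ : ℕ∞) (fun x : ℝ => (x, t)) univ := by fun_prop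
  exact contDiffOn_univ.1 (hf.smooth.comp h fun x _ => ⟨mem_univ _, ht⟩)

theorem dx (hf : SmoothST T f) : SmoothST T (fun x t => deriv (fun y => f y t) x) := by
  refine ⟨?_, fun x t ht => (hf.slice ht).deriv.per x⟩
  have hu : UniqueDiffOn ℝ ((univ : Set ℝ) ×ˢ Ico (0 : ℝ) T) :=
    uniqueDiffOn_univ.prod (uniqueDiffOn_Ico 0 T)
  have h1 := (hf.smooth.fderivWithin hu (m := (⊤ : ℕ∞)) (by simp)).clm_apply
    (contDiffOn_const (c := ((1 : ℝ), (0 : ℝ))))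
  refine h1.congr fun q hq => ?_
  have hd := (hf.smooth.differentiableOn (by simp) q hq).hasFDerivWithinAt
  have hl : HasDerivWithinAt (fun y : ℝ => (y, q.2)) ((1 : ℝ), (0 : ℝ)) univ q.1 :=
    (hasDerivWithinAt_id _ _).prodMk (hasDerivWithinAt_const _ _ _)
  have hm : MapsTo (fun y : ℝ => (y, q.2)) univ ((univ : Set ℝ) ×ˢ Ico (0 : ℝ) T) :=
    fun x _ => ⟨mem_univ _, hq.2⟩
  have := HasFDerivWithinAt.comp_hasDerivWithinAt (t := (univ : Set ℝ) ×ˢ Ico (0 : ℝ) T)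
    q.1 hd hl hm
  exact (hasDerivWithinAt_univ.1 this).deriv

theorem exists_bound (hf : SmoothST T f) {t₁ : ℝ} (ht : t₁ < T) :
    ∃ C, ∀ t ∈ Icc 0 t₁, ∀ θ ∈ Icc (0 : ℝ) (2 * Real.pi), |f θ t| ≤ C := by
  have hc : IsCompact (Icc (0 : ℝ) (2 * Real.pi) ×ˢ Icc 0 t₁) := isCompact_Icc.prod isCompact_Icc
  obtain ⟨C, hC⟩ := hc.exists_bound_of_continuousOn (hf.smooth.continuousOn.mono
    (prod_mono (subset_univ _) (Icc_subset_Ico_right ht)))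
  exact ⟨C, fun t h θ hθ => hC (θ, t) ⟨hθ, h⟩⟩

theorem exists_decay (hf : SmoothST T f) {t₁ : ℝ} (ht : t₁ < T) :
    ∃ C, 0 ≤ C ∧ ∀ t ∈ Icc 0 t₁, ∀ n : ℤ,
      ‖fCoeff (fun x => f x t) n‖ ≤ C * (1 / (1 + (n : ℝ) ^ 4)) := by
  obtain ⟨C₀, h0⟩ := hf.exists_bound ht
  obtain ⟨C₄, h4⟩ := hf.dx.dx.dx.dx.exists_bound ht
  refine ⟨|C₀ + C₄|, abs_nonneg _, fun t h n => ?_⟩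
  refine (norm_fCoeff_le_of_deriv_four (hf.slice (Icc_subset_Ico_right ht h)) (h0 t h) (h4 t h)
    n).trans ?_
  gcongr
  exact le_abs_self _

theorem continuousOn_fCoeff (hf : SmoothST T f) (n : ℤ) :
    ContinuousOn (fun t => fCoeff (fun x => f x t) n) (Ico 0 T) := by
  intro t₀ ht₀
  obtain ⟨t₁, h1, h2⟩ := exists_between ht₀.2
  have h01 : (0 : ℝ) ≤ t₁ := ht₀.1.trans h1.le
  let P : ℝ → ℝ := fun t => (projIcc 0 t₁ h01 t : ℝ)
  have cP : Continuous P := continuous_subtype_val.comp continuous_projIcc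
  have mP : ∀ t, P t ∈ Ico 0 T := fun t => Icc_subset_Ico_right h2 (projIcc 0 t₁ h01 t).2
  have cf : Continuous (fun q : ℝ × ℝ => f q.2 (P q.1)) := by
    have : Continuous (fun q : ℝ × ℝ => (q.2, P q.1)) := by fun_prop
    exact hf.smooth.continuousOn.comp_continuous this fun q => ⟨mem_univ _, mP _⟩
  have cF : Continuous (fun t => fCoeff (fun x => f x (P t)) n) := by
    unfold fCoeff
    refine continuous_const.mul
      (intervalIntegral.continuous_parametric_intervalIntegral_of_continuous' ?_ _ _)
    refine (Complex.continuous_ofReal.comp cf).mul ?_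
    exact (continuous_fourier_mode n).comp continuous_snd
  refine (cF.continuousWithinAt (s := Ico 0 T) (x := t₀)).congr_of_eventuallyEq ?_ ?_
  · filter_upwards [self_mem_nhdsWithin, mem_nhdsWithin_of_mem_nhds (Iio_mem_nhds h1)] with t a b
    simp only [P, projIcc_of_mem h01 ⟨a.1, b.le⟩]
  · simp only [P, projIcc_of_mem h01 ⟨ht₀.1, h1.le⟩]

theorem hasDerivAt_fCoeff (hf : SmoothST T f) (hg : SmoothST T g)
    (hd : ∀ θ, ∀ t ∈ Ioo 0 T, HasDerivAt (fun s => f θ s) (g θ t) t) (n : ℤ) {t : ℝ}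
    (ht : t ∈ Ioo 0 T) :
    HasDerivAt (fun s => fCoeff (fun x => f x s) n) (fCoeff (fun x => g x t) n) t := by
  obtain ⟨t₁, h1, h2⟩ := exists_between ht.2
  obtain ⟨C, hC⟩ := hg.exists_bound h2
  have hs : Ioo 0 t₁ ∈ nhds t := Ioo_mem_nhds ht.1 h1
  have sub : ∀ s ∈ Ioo 0 t₁, s ∈ Ico 0 T := fun s h => ⟨h.1.le, h.2.trans h2⟩
  have hpi : (0 : ℝ) ≤ 2 * Real.pi := by positivity
  have := intervalIntegral.hasDerivAt_integral_of_dominated_loc_of_deriv_le (μ := volume)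
    (a := 0) (b := 2 * Real.pi) (x₀ := t)
    (F := fun s θ => (f θ s : ℂ) * Complex.exp (-(Complex.I * n * θ)))
    (F' := fun s θ => (g θ s : ℂ) * Complex.exp (-(Complex.I * n * θ)))
    (bound := fun _ => C) hs ?_ ?_ ?_ ?_ ?_ ?_
  · unfold fCoeff
    exact this.2.const_mul _
  · filter_upwards [hs] with s h
    exact ((Complex.continuous_ofReal.comp (hf.slice (sub s h)).continuous).mul
      (continuous_fourier_mode n)).aestronglyMeasurable
  · exact intervalIntegrable_mode (hf.slice ⟨ht.1.le, ht.2⟩).continuous n _ _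
  · exact ((Complex.continuous_ofReal.comp (hg.slice ⟨ht.1.le, ht.2⟩).continuous).mul
      (continuous_fourier_mode n)).aestronglyMeasurable
  · refine ae_of_all _ fun θ hθ s h => ?_
    rw [uIoc_of_le hpi] at hθ
    rw [norm_mul, norm_fourier_mode, mul_one, Complex.norm_real]
    exact hC s ⟨h.1.le, h.2.le⟩ θ ⟨hθ.1.le, hθ.2⟩
  · exact intervalIntegrable_const
  · exact ae_of_all _ fun θ _ s h =>
      ((hd θ s ⟨h.1, h.2.trans h2⟩).ofReal_comp).mul_const _

end SmoothST

/-! ### The flow of the reciprocal curvature -/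

theorem fCoeff_neg (f : ℝ → ℝ) (n : ℤ) : fCoeff f (-n) = starRingEnd ℂ (fCoeff f n) := by
  unfold fCoeff
  rw [map_mul, ← intervalIntegral.intervalIntegral_conj]
  congr 1
  · simp [Complex.conj_ofNat]
  · refine intervalIntegral.integral_congr fun θ _ => ?_
    simp only [map_mul, Complex.conj_ofReal, ← Complex.exp_conj, map_neg, Complex.conj_I,
      map_intCast]
    push_cast
    ring_nf

theorem fCoeff_zero (f : ℝ → ℝ) :
    fCoeff f 0 = (((1 / (2 * Real.pi)) * ∫ θ in (0:ℝ)..(2 * Real.pi), f θ : ℝ) : ℂ) := by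
  unfold fCoeff
  simp only [Int.cast_zero, mul_zero, zero_mul, neg_zero, Complex.exp_zero, mul_one]
  rw [intervalIntegral.integral_ofReal]
  push_cast
  rfl

theorem fCoeff_zero_re_pos {f : ℝ → ℝ} (hf : Continuous f) (h : ∀ x, 0 < f x) :
    0 < (fCoeff f 0).re := by
  rw [fCoeff_zero, Complex.ofReal_re]
  have hpi := Real.pi_pos
  have := intervalIntegral.intervalIntegral_pos_of_pos (hf.intervalIntegrable 0 (2 * Real.pi)) h
    (by positivity)
  positivity

theorem ofReal_fCoeff_zero_re (f : ℝ → ℝ) : (((fCoeff f 0).re : ℝ) : ℂ) = fCoeff f 0 := by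
  rw [fCoeff_zero, Complex.ofReal_re]

/-- The evolution of a positive curvature function through its reciprocal, together with the
closing condition. -/
structure CurvFlow (p : ℕ) (T : ℝ) (k : ℝ → ℝ → ℝ) : Prop where
  smooth : SmoothST T k
  pos : ∀ θ, ∀ t ∈ Ico 0 T, 0 < k θ t
  evol : ∀ θ, ∀ t ∈ Ioo 0 T, HasDerivAt (fun s => (k θ s)⁻¹)
    (-(1 / (p : ℝ)) * (deriv (fun y => deriv (fun x => k x t ^ p) y) θ + k θ t ^ p)) t
  closing : ∀ t ∈ Ico 0 T, fCoeff (fun x => (k x t)⁻¹) 1 = 0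

theorem IsPCSF.curvFlow {p : ℕ} (hp : 1 ≤ p) {T : ℝ} {k : ℝ → ℝ → ℝ} {ψ : ℝ → ℝ}
    (h : IsPCSF p T k ψ) : CurvFlow p T k := by
  obtain ⟨h1, h2, h3, h4, -, -, -, -, -, h5⟩ := h
  have hs : SmoothST T k := ⟨h1, fun θ t _ => h2 θ t⟩
  have hp0 : (p : ℝ) ≠ 0 := by positivity
  refine ⟨hs, h3, fun θ t ht => ?_, fun t ht => ?_⟩
  · have ht' : t ∈ Ico 0 T := ⟨ht.1.le, ht.2⟩
    have sl := hs.slice ht'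
    have d1 : (fun y => deriv (fun x => k x t ^ p) y)
        = fun y => (p : ℝ) * k y t ^ (p - 1) * deriv (fun x => k x t) y :=
      funext fun y => ((sl.hasDerivAt y).pow p).deriv
    have d2 := ((((sl.hasDerivAt θ).pow (p - 1)).const_mul (p : ℝ)).mul
      (sl.deriv.hasDerivAt θ)).deriv
    have e : (fun y => (p : ℝ) * k y t ^ (p - 1) * deriv (fun x => k x t) y)
        = (fun y => (p : ℝ) * ((fun x => k x t) ^ (p - 1)) y) * (deriv fun x => k x t) := rfl
    rw [d1, e, d2]
    have kp := h3 θ t ht'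
    refine ((h4 θ t ht').inv kp.ne').congr_deriv ?_
    have hp1 : ((p - 1 : ℕ) : ℝ) = p - 1 := by rw [Nat.cast_sub hp, Nat.cast_one]
    have hp2 : p - 1 - 1 = p - 2 := by omega
    rw [hp1, hp2]
    simp only [Pi.pow_apply]
    field_simp
    ring
  · have e : fCoeff (fun x => (k x t)⁻¹) (-1) = 0 := by
      unfold fCoeff
      have : ∀ θ : ℝ, (((k θ t)⁻¹ : ℝ) : ℂ) * Complex.exp (-(Complex.I * ((-1 : ℤ) : ℂ) * θ))
          = Complex.exp (Complex.I * θ) / (k θ t) := by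
        intro θ
        push_cast
        rw [div_eq_inv_mul]
        congr 2
        ring
      simp only [this, h5 t ht, mul_zero]
    rw [fCoeff_neg] at e
    simpa using e

namespace CurvFlow

variable {p : ℕ} {T : ℝ} {k : ℝ → ℝ → ℝ}

/-- Fourier coefficients of the radius of curvature `1/k`. -/
noncomputable def rho (k : ℝ → ℝ → ℝ) (n : ℤ) (t : ℝ) : ℂ := fCoeff (fun x => (k x t)⁻¹) n

/-- Fourier coefficients of `k^p`. -/
noncomputable def spd (p : ℕ) (k : ℝ → ℝ → ℝ) (n : ℤ) (t : ℝ) : ℂ := fCoeff (fun x => k x t ^ p) n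

/-- The mean radius of curvature. -/
noncomputable def rad (k : ℝ → ℝ → ℝ) (t : ℝ) : ℝ := (rho k 0 t).re

/-- The mean of `k^p`. -/
noncomputable def mspd (p : ℕ) (k : ℝ → ℝ → ℝ) (t : ℝ) : ℝ := (spd p k 0 t).re

theorem smooth_inv (h : CurvFlow p T k) : SmoothST T (fun x t => (k x t)⁻¹) :=
  h.smooth.inv fun θ t ht => (h.pos θ t ht).ne'

theorem rad_pos (h : CurvFlow p T k) {t : ℝ} (ht : t ∈ Ico 0 T) : 0 < rad k t :=
  fCoeff_zero_re_pos (h.smooth_inv.slice ht).continuous fun x => inv_pos.2 (h.pos x t ht)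

theorem mspd_pos (h : CurvFlow p T k) {t : ℝ} (ht : t ∈ Ico 0 T) : 0 < mspd p k t :=
  fCoeff_zero_re_pos ((h.smooth.pow p).slice ht).continuous fun x => pow_pos (h.pos x t ht) p

theorem rho_one (h : CurvFlow p T k) {t : ℝ} (ht : t ∈ Ico 0 T) : rho k 1 t = 0 := h.closing t ht

theorem rho_neg_one (h : CurvFlow p T k) {t : ℝ} (ht : t ∈ Ico 0 T) : rho k (-1) t = 0 := by
  rw [rho, fCoeff_neg, h.closing t ht, map_zero]

theorem hasDerivAt_rho (h : CurvFlow p T k) (n : ℤ) {t : ℝ} (ht : t ∈ Ioo 0 T) :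
    HasDerivAt (rho k n) ((((n : ℝ) ^ 2 - 1) / p : ℝ) * spd p k n t) t := by
  have hV := h.smooth.pow p
  have := h.smooth_inv.hasDerivAt_fCoeff ((hV.dx.dx.add hV).const_mul (-(1 / (p : ℝ)))) h.evol n ht
  refine this.congr_deriv ?_
  have ht' : t ∈ Ico 0 T := ⟨ht.1.le, ht.2⟩
  have sV := hV.slice ht'
  rw [fCoeff_const_mul, fCoeff_add sV.deriv.deriv.continuous sV.continuous, fCoeff_deriv_deriv sV,
    spd]
  push_cast
  ring

theorem hasDerivAt_rad (h : CurvFlow p T k) {t : ℝ} (ht : t ∈ Ioo 0 T) :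
    HasDerivAt (rad k) (-(mspd p k t / p)) t := by
  have := h.hasDerivAt_rho 0 ht
  have h2 := (Complex.reCLM.hasFDerivAt.comp_hasDerivAt t this)
  refine h2.congr_deriv ?_
  rw [Complex.reCLM_apply, Complex.re_ofReal_mul, mspd]
  push_cast
  ring

theorem continuousOn_rho (h : CurvFlow p T k) (n : ℤ) : ContinuousOn (rho k n) (Ico 0 T) :=
  h.smooth_inv.continuousOn_fCoeff n

theorem continuousOn_spd (h : CurvFlow p T k) (n : ℤ) : ContinuousOn (spd p k n) (Ico 0 T) :=
  (h.smooth.pow p).continuousOn_fCoeff n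

theorem continuousOn_rad (h : CurvFlow p T k) : ContinuousOn (rad k) (Ico 0 T) :=
  Complex.continuous_re.comp_continuousOn (h.continuousOn_rho 0)

theorem continuousOn_mspd (h : CurvFlow p T k) : ContinuousOn (mspd p k) (Ico 0 T) :=
  Complex.continuous_re.comp_continuousOn (h.continuousOn_spd 0)

theorem antitoneOn_rad (h : CurvFlow p T k) : AntitoneOn (rad k) (Ico 0 T) := by
  refine antitoneOn_of_deriv_nonpos (convex_Ico 0 T) h.continuousOn_rad ?_ ?_ <;>
    rw [interior_Ico] <;> intro t ht
  · exact (h.hasDerivAt_rad ht).differentiableAt.differentiableWithinAt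
  · rw [(h.hasDerivAt_rad ht).deriv]
    have := (h.mspd_pos ⟨ht.1.le, ht.2⟩).le
    have : 0 ≤ mspd p k t / p := by positivity
    linarith

end CurvFlow

/-! ### The normalised deviation from a circle -/

/-- The exponential weight `exp (σ min(|n|, M))`. -/
noncomputable def expWeight (σ : ℝ) (M : ℕ) (n : ℤ) : ℝ := Real.exp (σ * min (|(n : ℝ)|) M)

theorem isWeight_expWeight {σ : ℝ} (hσ : 0 ≤ σ) (M : ℕ) : IsWeight (expWeight σ M) where
  one_le n := Real.one_le_exp (by positivity)
  mul_le m n := by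
    have hM : (0 : ℝ) ≤ M := Nat.cast_nonneg M
    have h : min (|((m + n : ℤ) : ℝ)|) (M : ℝ) ≤ min (|(m : ℝ)|) M + min (|(n : ℝ)|) M := by
      have := abs_add_le (m : ℝ) n
      push_cast
      have am := abs_nonneg (m : ℝ)
      have an := abs_nonneg (n : ℝ)
      rcases le_total (|(m : ℝ)|) (M : ℝ) with h1 | h1 <;>
        rcases le_total (|(n : ℝ)|) (M : ℝ) with h2 | h2 <;>
        simp only [h1, h2, min_eq_left, min_eq_right, min_le_iff]
      · left; linarith
      · right; linarith
      · right; linarith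
      · right; linarith
    rw [expWeight, expWeight, expWeight, ← Real.exp_add, ← mul_add]
    gcongr
  bdd := ⟨Real.exp (σ * M), fun n => by unfold expWeight; gcongr; exact min_le_right _ _⟩

theorem expWeight_zero (M : ℕ) (n : ℤ) : expWeight 0 M n = 1 := by simp [expWeight]

namespace CurvFlow

variable {p : ℕ} {T : ℝ} {k : ℝ → ℝ → ℝ}

/-- The relative deviation of the radius of curvature from its mean. -/
noncomputable def dev (k : ℝ → ℝ → ℝ) (t : ℝ) (x : ℝ) : ℝ := (rad k t)⁻¹ * (k x t)⁻¹ - 1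

/-- The relative deviation of the curvature from the inverse of the mean radius. -/
noncomputable def exc (k : ℝ → ℝ → ℝ) (t : ℝ) (x : ℝ) : ℝ := rad k t * k x t - 1

/-- The nonlinear part of the normalised speed. -/
noncomputable def nonlin (p : ℕ) (k : ℝ → ℝ → ℝ) (t : ℝ) (x : ℝ) : ℝ :=
  (1 + exc k t x) ^ p - 1 + p * dev k t x

variable {t : ℝ}

theorem smoothPer_dev (h : CurvFlow p T k) (ht : t ∈ Ico 0 T) : SmoothPer (dev k t) :=
  ((h.smooth_inv.slice ht).const_mul _).sub (.const 1)

theorem smoothPer_exc (h : CurvFlow p T k) (ht : t ∈ Ico 0 T) : SmoothPer (exc k t) :=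
  ((h.smooth.slice ht).const_mul _).sub (.const 1)

theorem smoothPer_nonlin (h : CurvFlow p T k) (ht : t ∈ Ico 0 T) : SmoothPer (nonlin p k t) :=
  ((((SmoothPer.const 1).add (h.smoothPer_exc ht)).pow p).sub (.const 1)).add
    ((h.smoothPer_dev ht).const_mul _)

theorem exc_mul_dev (h : CurvFlow p T k) (ht : t ∈ Ico 0 T) (x : ℝ) :
    (1 + exc k t x) * (1 + dev k t x) = 1 := by
  have h1 := (h.pos x t ht).ne'
  have h2 := (h.rad_pos ht).ne'
  unfold exc dev
  field_simp
  ring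

theorem fCoeff_dev (h : CurvFlow p T k) (ht : t ∈ Ico 0 T) {n : ℤ} (hn : n ≠ 0) :
    fCoeff (dev k t) n = ((rad k t)⁻¹ : ℝ) * rho k n t := by
  have s := (h.smooth_inv.slice ht)
  have := fCoeff_sub (f := fun x => (rad k t)⁻¹ * (k x t)⁻¹) (g := fun _ => 1)
    (s.const_mul _).continuous continuous_const n
  unfold dev
  rw [this, fCoeff_const_mul, fCoeff_one, if_neg hn, sub_zero, rho]

theorem fCoeff_dev_zero (h : CurvFlow p T k) (ht : t ∈ Ico 0 T) : fCoeff (dev k t) 0 = 0 := by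
  have s := (h.smooth_inv.slice ht)
  have := fCoeff_sub (f := fun x => (rad k t)⁻¹ * (k x t)⁻¹) (g := fun _ => 1)
    (s.const_mul _).continuous continuous_const 0
  unfold dev
  rw [this, fCoeff_const_mul, fCoeff_one, if_pos rfl, ← ofReal_fCoeff_zero_re]
  have e : (fCoeff (fun x => (k x t)⁻¹) 0).re = rad k t := rfl
  rw [e, ← Complex.ofReal_mul, inv_mul_cancel₀ (h.rad_pos ht).ne', Complex.ofReal_one, sub_self]

theorem fCoeff_dev_eq_zero (h : CurvFlow p T k) (ht : t ∈ Ico 0 T) {n : ℤ} (hn : |n| < 2) :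
    fCoeff (dev k t) n = 0 := by
  rw [abs_lt] at hn
  obtain rfl | rfl | rfl : n = -1 ∨ n = 0 ∨ n = 1 := by omega
  · rw [h.fCoeff_dev ht (by decide), h.rho_neg_one ht, mul_zero]
  · exact h.fCoeff_dev_zero ht
  · rw [h.fCoeff_dev ht (by decide), h.rho_one ht, mul_zero]

theorem four_mul_wnorm_dev_le (h : CurvFlow p T k) (ht : t ∈ Ico 0 T) {ω : ℤ → ℝ}
    (hω : IsWeight ω) : 4 * wnorm ω (dev k t) ≤ wnorm2 ω (dev k t) := by
  have s := h.smoothPer_dev ht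
  unfold wnorm wnorm2
  rw [← tsum_mul_left]
  refine ((hω.summable s).mul_left 4).tsum_le_tsum (fun n => ?_) (hω.summable2 s)
  rcases lt_or_ge |n| 2 with hn | hn
  · rw [h.fCoeff_dev_eq_zero ht hn]
    simp
  · have h2 : (2 : ℝ) ≤ |(n : ℝ)| := by exact_mod_cast hn
    have : (4 : ℝ) ≤ (n : ℝ) ^ 2 := by rw [← sq_abs]; nlinarith
    have := (hω.pos n).le
    gcongr

theorem nonlin_eq (p : ℕ) (k : ℝ → ℝ → ℝ) (t : ℝ) : nonlin p k t =
    fun x => (rad k t ^ p * k x t ^ p + p * (rad k t)⁻¹ * (k x t)⁻¹) - (1 + p : ℝ) * 1 := by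
  funext x
  unfold nonlin exc dev
  rw [add_sub_cancel, mul_pow]
  ring

theorem fCoeff_nonlin (h : CurvFlow p T k) (ht : t ∈ Ico 0 T) (n : ℤ) :
    fCoeff (nonlin p k t) n = (rad k t ^ p : ℝ) * spd p k n t
      + (p * (rad k t)⁻¹ : ℝ) * rho k n t - (1 + p : ℝ) * if n = 0 then 1 else 0 := by
  have s1 := h.smooth_inv.slice ht
  have s2 := (h.smooth.pow p).slice ht
  have c1 := s1.const_mul (p * (rad k t)⁻¹ : ℝ)
  have c2 := s2.const_mul (rad k t ^ p)
  rw [nonlin_eq, fCoeff_sub (g := fun _ => (1 + p : ℝ) * 1) (c2.add c1).continuous continuous_const,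
    fCoeff_add c2.continuous c1.continuous, fCoeff_const_mul, fCoeff_const_mul, fCoeff_const_mul,
    fCoeff_one]
  push_cast
  rfl

theorem fCoeff_nonlin_of_ne (h : CurvFlow p T k) (ht : t ∈ Ico 0 T) {n : ℤ} (hn : n ≠ 0) :
    fCoeff (nonlin p k t) n = (rad k t ^ p : ℝ) * spd p k n t
      + (p * (rad k t)⁻¹ : ℝ) * rho k n t := by
  rw [h.fCoeff_nonlin ht, if_neg hn, mul_zero, sub_zero]

theorem abs_rad_pow_mul_mspd_sub_one_le (h : CurvFlow p T k) (ht : t ∈ Ico 0 T) {ω : ℤ → ℝ}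
    (hω : IsWeight ω) : |rad k t ^ p * mspd p k t - 1| ≤ wnorm ω (nonlin p k t) := by
  have e : fCoeff (nonlin p k t) 0 = ((rad k t ^ p * mspd p k t - 1 : ℝ) : ℂ) := by
    have e1 : rho k 0 t = (rad k t : ℂ) := (ofReal_fCoeff_zero_re _).symm
    have e2 : spd p k 0 t = (mspd p k t : ℂ) := (ofReal_fCoeff_zero_re _).symm
    have h0 : (rad k t : ℂ) ≠ 0 := by exact_mod_cast (h.rad_pos ht).ne'
    rw [h.fCoeff_nonlin ht, if_pos rfl, e1, e2]
    push_cast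
    field_simp
    ring
  have := norm_fCoeff_le_wnorm hω (h.smoothPer_nonlin ht) 0
  rwa [e, Complex.norm_real, Real.norm_eq_abs] at this

end CurvFlow

/-! ### Monotonicity of weighted norms along the flow -/

theorem expWeight_le {ξ t b : ℝ} (hξ : 0 ≤ ξ) (ht : 0 ≤ t) (htb : t ≤ b) (M : ℕ) (n : ℤ) :
    expWeight (ξ * t) M n ≤ Real.exp (ξ * b * M) := by
  unfold expWeight
  have hm := min_le_right (|(n : ℝ)|) (M : ℝ)
  have hb := ht.trans htb
  gcongr

namespace CurvFlow

variable {p : ℕ} {T : ℝ} {k : ℝ → ℝ → ℝ}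

/-- The growth rate of the `n`-th mode of `1/k` weighted by `expWeight (ξ t) M n` and by a factor
with logarithmic derivative `l`. -/
noncomputable def modeRate (p : ℕ) (k : ℝ → ℝ → ℝ) (l : ℝ → ℝ) (ξ : ℝ) (M : ℕ) (n : ℤ)
    (t : ℝ) : ℝ :=
  l t + ξ * min (|(n : ℝ)|) M - ((n : ℝ) ^ 2 - 1) * (rad k t ^ (p + 1))⁻¹

/-- The nonlinear forcing of the `n`-th mode of `1/k`. -/
noncomputable def forcing (p : ℕ) (k : ℝ → ℝ → ℝ) (n : ℤ) (t : ℝ) : ℂ :=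
  (((n : ℝ) ^ 2 - 1) / p : ℝ) * (spd p k n t + (p * (rad k t ^ (p + 1))⁻¹ : ℝ) * rho k n t)

theorem forcing_eq (h : CurvFlow p T k) {t : ℝ} (ht : t ∈ Ico 0 T) {n : ℤ} (hn : n ≠ 0) :
    forcing p k n t
      = ((((n : ℝ) ^ 2 - 1) / p * (rad k t ^ p)⁻¹ : ℝ) : ℂ) * fCoeff (nonlin p k t) n := by
  have h0 : (rad k t : ℂ) ≠ 0 := by exact_mod_cast (h.rad_pos ht).ne'
  rw [forcing, h.fCoeff_nonlin_of_ne ht hn]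
  push_cast
  field_simp
  ring

/-- The growth bound for the modulus of the `n`-th weighted mode. -/
noncomputable def modeBound (p : ℕ) (k : ℝ → ℝ → ℝ) (m l : ℝ → ℝ) (ξ : ℝ) (M : ℕ) (n : ℤ)
    (t : ℝ) : ℝ :=
  if n = 0 then 0 else m t * expWeight (ξ * t) M n *
    (modeRate p k l ξ M n t * ‖rho k n t‖ + ‖forcing p k n t‖)

/-- The `n`-th weighted mode. -/
noncomputable def mode (k : ℝ → ℝ → ℝ) (m : ℝ → ℝ) (ξ : ℝ) (M : ℕ) (n : ℤ) (t : ℝ) : ℂ :=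
  if n = 0 then 0 else ((m t * expWeight (ξ * t) M n : ℝ) : ℂ) * rho k n t

theorem hasDerivAt_mode (h : CurvFlow p T k) {m l : ℝ → ℝ} {t : ℝ} (ht : t ∈ Ioo 0 T)
    (hm : HasDerivAt m (m t * l t) t) (hp : 1 ≤ p) (ξ : ℝ) (M : ℕ) {n : ℤ} (hn : n ≠ 0) :
    HasDerivAt (mode k m ξ M n) (((m t * expWeight (ξ * t) M n : ℝ) : ℂ)
      * ((modeRate p k l ξ M n t : ℝ) * rho k n t + forcing p k n t)) t := by
  have hp0 : (p : ℂ) ≠ 0 := by exact_mod_cast (by omega : p ≠ 0)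
  have hw : HasDerivAt (fun s => expWeight (ξ * s) M n)
      (expWeight (ξ * t) M n * (ξ * min (|(n : ℝ)|) M)) t := by
    have := (((hasDerivAt_id t).const_mul ξ).mul_const (min (|(n : ℝ)|) (M : ℝ))).exp
    refine this.congr_deriv ?_
    simp [expWeight]
  have h1 := ((hm.mul hw).ofReal_comp).mul (h.hasDerivAt_rho n ht)
  have e : mode k m ξ M n = fun s => ((m s * expWeight (ξ * s) M n : ℝ) : ℂ) * rho k n s := by
    funext s
    rw [mode, if_neg hn]
  rw [e]
  refine h1.congr_deriv ?_
  rw [modeRate, forcing, Pi.mul_apply]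
  push_cast
  field_simp
  ring

theorem inner_mode_le {c s : ℝ} (hc : 0 ≤ c) (z g : ℂ) :
    (inner ℝ ((c : ℂ) * z) ((c : ℂ) * ((s : ℂ) * z + g)) : ℝ)
      ≤ c * (s * ‖z‖ + ‖g‖) * ‖(c : ℂ) * z‖ := by
  have e1 : ∀ x : ℂ, (c : ℂ) * x = c • x := fun x => (Complex.real_smul).symm
  have e2 : (s : ℂ) * z = s • z := (Complex.real_smul).symm
  have i := real_inner_le_norm z g
  rw [e1, e1, e2, real_inner_smul_left, real_inner_smul_right, inner_add_right,
    real_inner_smul_right, real_inner_self_eq_norm_sq, norm_smul, Real.norm_eq_abs, abs_of_nonneg hc]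
  have := mul_le_mul_of_nonneg_left i (mul_nonneg hc hc)
  nlinarith

theorem modeBound_le (h : CurvFlow p T k) (hp : 1 ≤ p) {t : ℝ} (ht : t ∈ Ico 0 T) {m : ℝ → ℝ}
    (hm : 0 ≤ m t) (l : ℝ → ℝ) {ξ : ℝ} (hξ : 0 ≤ ξ) (M : ℕ) (n : ℤ) :
    modeBound p k m l ξ M n t ≤ m t * (rad k t ^ p)⁻¹ *
      ((l t * rad k t ^ (p + 1) + 1) * (expWeight (ξ * t) M n * ‖fCoeff (dev k t) n‖)
      + (ξ * rad k t ^ (p + 1) - 1) * ((n : ℝ) ^ 2 * (expWeight (ξ * t) M n * ‖fCoeff (dev k t) n‖))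
      + 1 / p * ((n : ℝ) ^ 2 * (expWeight (ξ * t) M n * ‖fCoeff (nonlin p k t) n‖))) := by
  by_cases hn : n = 0
  · subst hn
    rw [h.fCoeff_dev_zero ht]
    simp [modeBound]
  have hR := h.rad_pos ht
  have hp0 : (0 : ℝ) < p := by exact_mod_cast hp
  have hw : 0 < expWeight (ξ * t) M n := Real.exp_pos _
  have n1 : (1 : ℝ) ≤ (n : ℝ) ^ 2 := by
    have : (1 : ℤ) ≤ n ^ 2 := Int.one_le_abs hn |> fun h => by rw [← sq_abs]; nlinarith
    exact_mod_cast this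
  have n2 : |(n : ℝ)| ≤ (n : ℝ) ^ 2 := by
    have : (1 : ℝ) ≤ |(n : ℝ)| := by exact_mod_cast Int.one_le_abs hn
    rw [← sq_abs]; nlinarith
  have er : ‖rho k n t‖ = rad k t * ‖fCoeff (dev k t) n‖ := by
    rw [h.fCoeff_dev ht hn, norm_mul, Complex.norm_real, Real.norm_eq_abs, abs_inv,
      abs_of_pos hR, mul_inv_cancel_left₀ hR.ne']
  have ef : ‖forcing p k n t‖ ≤ (rad k t ^ p)⁻¹ *
      (1 / p * ((n : ℝ) ^ 2 * ‖fCoeff (nonlin p k t) n‖)) := by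
    rw [h.forcing_eq ht hn, norm_mul, Complex.norm_real, Real.norm_eq_abs, abs_of_nonneg
      (mul_nonneg (div_nonneg (by linarith) hp0.le) (by positivity))]
    calc ((n : ℝ) ^ 2 - 1) / p * (rad k t ^ p)⁻¹ * ‖fCoeff (nonlin p k t) n‖
        ≤ (n : ℝ) ^ 2 / p * (rad k t ^ p)⁻¹ * ‖fCoeff (nonlin p k t) n‖ := by
          gcongr; linarith
      _ = _ := by ring
  have es : modeRate p k l ξ M n t * ‖rho k n t‖ ≤ (rad k t ^ p)⁻¹ *
      ((l t * rad k t ^ (p + 1) + 1) * ‖fCoeff (dev k t) n‖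
      + (ξ * rad k t ^ (p + 1) - 1) * ((n : ℝ) ^ 2 * ‖fCoeff (dev k t) n‖)) := by
    have : modeRate p k l ξ M n t
        ≤ l t + ξ * (n : ℝ) ^ 2 - ((n : ℝ) ^ 2 - 1) * (rad k t ^ (p + 1))⁻¹ := by
      unfold modeRate
      gcongr
      exact (min_le_left _ _).trans n2
    calc modeRate p k l ξ M n t * ‖rho k n t‖
        ≤ (l t + ξ * (n : ℝ) ^ 2 - ((n : ℝ) ^ 2 - 1) * (rad k t ^ (p + 1))⁻¹) * ‖rho k n t‖ := by
          gcongr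
      _ = _ := by
          rw [er, pow_succ]
          field_simp
          ring
  rw [modeBound, if_neg hn]
  calc _ ≤ m t * expWeight (ξ * t) M n * ((rad k t ^ p)⁻¹ *
      ((l t * rad k t ^ (p + 1) + 1) * ‖fCoeff (dev k t) n‖
      + (ξ * rad k t ^ (p + 1) - 1) * ((n : ℝ) ^ 2 * ‖fCoeff (dev k t) n‖))
      + (rad k t ^ p)⁻¹ * (1 / p * ((n : ℝ) ^ 2 * ‖fCoeff (nonlin p k t) n‖))) := by
        gcongr
    _ = _ := by ring

theorem norm_mode (h : CurvFlow p T k) {t : ℝ} (ht : t ∈ Ico 0 T) {m : ℝ → ℝ} (hm : 0 ≤ m t)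
    (ξ : ℝ) (M : ℕ) (n : ℤ) : ‖mode k m ξ M n t‖
      = m t * rad k t * (expWeight (ξ * t) M n * ‖fCoeff (dev k t) n‖) := by
  by_cases hn : n = 0
  · subst hn
    rw [h.fCoeff_dev_zero ht]
    simp [mode]
  have hR := h.rad_pos ht
  have hw : 0 < expWeight (ξ * t) M n := Real.exp_pos _
  rw [mode, if_neg hn, h.fCoeff_dev ht hn, norm_mul, norm_mul, Complex.norm_real,
    Complex.norm_real, Real.norm_eq_abs, Real.norm_eq_abs, abs_inv, abs_of_pos hR,
    abs_of_nonneg (by positivity)]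
  field_simp

theorem continuousOn_expWeight (ξ : ℝ) (M : ℕ) (n : ℤ) (s : Set ℝ) :
    ContinuousOn (fun t => expWeight (ξ * t) M n) s := by
  unfold expWeight
  fun_prop

theorem continuousOn_inv_rad_pow (h : CurvFlow p T k) (j : ℕ) :
    ContinuousOn (fun t => (rad k t ^ j)⁻¹) (Ico 0 T) :=
  (h.continuousOn_rad.pow j).inv₀ fun _ ht => (pow_pos (h.rad_pos ht) j).ne'

theorem continuousOn_mode (h : CurvFlow p T k) {m : ℝ → ℝ} {s : Set ℝ} (hs : s ⊆ Ico 0 T)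
    (hm : ContinuousOn m s) (ξ : ℝ) (M : ℕ) (n : ℤ) : ContinuousOn (mode k m ξ M n) s := by
  unfold mode
  by_cases hn : n = 0
  · simp only [hn, if_true]
    exact continuousOn_const
  · simp only [hn, if_false]
    exact (Complex.continuous_ofReal.comp_continuousOn
      (hm.mul (continuousOn_expWeight ξ M n s))).mul ((h.continuousOn_rho n).mono hs)

theorem continuousOn_modeBound (h : CurvFlow p T k) {m l : ℝ → ℝ} {s : Set ℝ}
    (hs : s ⊆ Ico 0 T) (hm : ContinuousOn m s) (hl : ContinuousOn l s) (ξ : ℝ) (M : ℕ) (n : ℤ) :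
    ContinuousOn (modeBound p k m l ξ M n) s := by
  unfold modeBound modeRate forcing
  by_cases hn : n = 0
  · simp only [hn, if_true]
    exact continuousOn_const
  · simp only [hn, if_false]
    have hr := (h.continuousOn_inv_rad_pow (p + 1)).mono hs
    have h1 := (h.continuousOn_rho n).mono hs
    have h2 := (h.continuousOn_spd n).mono hs
    have hw := continuousOn_expWeight ξ M n s
    refine (hm.mul hw).mul ((((hl.add continuousOn_const).sub
      (continuousOn_const.mul hr)).mul h1.norm).add ?_)
    exact (continuousOn_const.mul (h2.add ((Complex.continuous_ofReal.comp_continuousOn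
      (continuousOn_const.mul hr)).mul h1))).norm

theorem exists_summable_modeBound (h : CurvFlow p T k) (hp : 1 ≤ p) {m l : ℝ → ℝ} {b : ℝ}
    {s : Set ℝ} (hb : b < T) (hs : s ⊆ Icc 0 b) (hsc : IsCompact s)
    (hm : ContinuousOn m s) (hl : ContinuousOn l s) {ξ : ℝ} (hξ : 0 ≤ ξ) (M : ℕ) :
    ∃ B : ℤ → ℝ, Summable B ∧ ∀ n, ∀ t ∈ s, |modeBound p k m l ξ M n t| ≤ B n := by
  have hsT : s ⊆ Ico 0 T := hs.trans (Icc_subset_Ico_right hb)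
  obtain ⟨A₁, h1⟩ := hsc.exists_bound_of_continuousOn hl
  obtain ⟨A₂, h2⟩ := hsc.exists_bound_of_continuousOn ((h.continuousOn_inv_rad_pow (p + 1)).mono hsT)
  obtain ⟨A₃, h3⟩ := hsc.exists_bound_of_continuousOn hm
  obtain ⟨C, hC, dC⟩ := h.smooth_inv.exists_decay hb
  obtain ⟨D, hD, dD⟩ := (h.smooth.pow p).exists_decay hb
  have hp0 : (1 : ℝ) ≤ p := by exact_mod_cast hp
  refine ⟨fun n => |A₃| * Real.exp (ξ * b * M) * ((|A₁| + ξ * M + |A₂|) * C + (D + |A₂| * C)) *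
    ((1 + (n : ℝ) ^ 2) * (1 / (1 + (n : ℝ) ^ 4))), summable_int_quartic.mul_left _,
    fun n t ht => ?_⟩
  have tb := hs ht
  by_cases hn : n = 0
  · rw [modeBound, if_pos hn, abs_zero]
    positivity
  have b1 := (h1 t ht).trans (le_abs_self _)
  have b2 := (h2 t ht).trans (le_abs_self _)
  have b3 := (h3 t ht).trans (le_abs_self _)
  rw [Real.norm_eq_abs] at b1 b2 b3
  set d : ℝ := 1 / (1 + (n : ℝ) ^ 4) with hd
  have d0 : 0 ≤ d := by positivity
  have b4 : ‖rho k n t‖ ≤ C * d := dC t tb n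
  have b5 : ‖spd p k n t‖ ≤ D * d := dD t tb n
  have bw : |expWeight (ξ * t) M n| ≤ Real.exp (ξ * b * M) := by
    rw [abs_of_pos (show 0 < expWeight (ξ * t) M n from Real.exp_pos _)]
    exact expWeight_le hξ tb.1 tb.2 M n
  have n1 : |(n : ℝ) ^ 2 - 1| ≤ 1 + (n : ℝ) ^ 2 := by
    rw [abs_le]; constructor <;> nlinarith [sq_nonneg (n : ℝ)]
  have bs : |modeRate p k l ξ M n t| ≤ (|A₁| + ξ * M + |A₂|) * (1 + (n : ℝ) ^ 2) := by
    have c1 : |ξ * min (|(n : ℝ)|) (M : ℝ)| ≤ ξ * M := by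
      rw [abs_of_nonneg (by positivity)]
      gcongr
      exact min_le_right _ _
    have c2 : |((n : ℝ) ^ 2 - 1) * (rad k t ^ (p + 1))⁻¹| ≤ (1 + (n : ℝ) ^ 2) * |A₂| := by
      rw [abs_mul]
      gcongr
    have c3 := abs_sub (l t + ξ * min (|(n : ℝ)|) (M : ℝ))
      (((n : ℝ) ^ 2 - 1) * (rad k t ^ (p + 1))⁻¹)
    have c4 := abs_add_le (l t) (ξ * min (|(n : ℝ)|) (M : ℝ))
    have c5 : 0 ≤ (|A₁| + ξ * M) * (n : ℝ) ^ 2 := by positivity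
    unfold modeRate
    nlinarith
  have bf : ‖forcing p k n t‖ ≤ (1 + (n : ℝ) ^ 2) * ((D + |A₂| * C) * d) := by
    rw [forcing, norm_mul, Complex.norm_real, Real.norm_eq_abs, abs_div, Nat.abs_cast]
    have e : ‖spd p k n t + (p * (rad k t ^ (p + 1))⁻¹ : ℝ) * rho k n t‖
        ≤ D * d + p * |A₂| * (C * d) := by
      refine (norm_add_le _ _).trans ?_
      rw [norm_mul, Complex.norm_real, Real.norm_eq_abs, abs_mul, Nat.abs_cast]
      gcongr
    calc |(n : ℝ) ^ 2 - 1| / p * _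
        ≤ (1 + (n : ℝ) ^ 2) / p * (D * d + p * |A₂| * (C * d)) := by gcongr
      _ ≤ (1 + (n : ℝ) ^ 2) / p * (p * (D * d) + p * |A₂| * (C * d)) := by
          have : D * d ≤ p * (D * d) := le_mul_of_one_le_left (mul_nonneg hD d0) hp0
          gcongr ?_ * (?_ + _)
      _ = _ := by field_simp
  rw [modeBound, if_neg hn, abs_mul, abs_mul]
  have e1 : |modeRate p k l ξ M n t * ‖rho k n t‖ + ‖forcing p k n t‖|
      ≤ (|A₁| + ξ * M + |A₂|) * (1 + (n : ℝ) ^ 2) * (C * d)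
        + (1 + (n : ℝ) ^ 2) * ((D + |A₂| * C) * d) := by
    refine (abs_add_le _ _).trans ?_
    rw [abs_mul, abs_norm, abs_norm]
    gcongr
  calc _ ≤ |A₃| * Real.exp (ξ * b * M) * ((|A₁| + ξ * M + |A₂|) * (1 + (n : ℝ) ^ 2) * (C * d)
        + (1 + (n : ℝ) ^ 2) * ((D + |A₂| * C) * d)) := by gcongr
    _ = _ := by ring

/-- If the linear dissipation dominates on `(a,b)`, the norm of the deviation, weighted by a factor
`m` with logarithmic derivative `l`, does not increase. -/
theorem weighted_wnorm_le_of_pos (h : CurvFlow p T k) (hp : 1 ≤ p) {a b : ℝ} (ha : 0 < a)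
    (hab : a ≤ b) (hb : b < T) {m l : ℝ → ℝ} (hm : ∀ t ∈ Icc a b, 0 < m t)
    (hl : ContinuousOn l (Icc a b)) (hml : ∀ t ∈ Icc a b, HasDerivAt m (m t * l t) t)
    {ξ : ℝ} (hξ : 0 ≤ ξ) (M : ℕ)
    (hd : ∀ t ∈ Ioo a b,
      (l t * rad k t ^ (p + 1) + 1) * wnorm (expWeight (ξ * t) M) (dev k t)
      + (ξ * rad k t ^ (p + 1) - 1) * wnorm2 (expWeight (ξ * t) M) (dev k t)
      + 1 / p * wnorm2 (expWeight (ξ * t) M) (nonlin p k t) ≤ 0) :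
    m b * rad k b * wnorm (expWeight (ξ * b) M) (dev k b)
      ≤ m a * rad k a * wnorm (expWeight (ξ * a) M) (dev k a) := by
  have hs : Icc a b ⊆ Ico 0 T := fun t ht => ⟨ha.le.trans ht.1, ht.2.trans_lt hb⟩
  have hs' : Icc a b ⊆ Icc 0 b := Icc_subset_Icc_left ha.le
  have hmc : ContinuousOn m (Icc a b) := fun t ht => (hml t ht).continuousAt.continuousWithinAt
  have hW : ∀ t ∈ Icc a b, IsWeight (expWeight (ξ * t) M) := fun t ht =>
    isWeight_expWeight (mul_nonneg hξ (hs ht).1) M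
  obtain ⟨B, hB, hhB⟩ := h.exists_summable_modeBound hp hb hs' isCompact_Icc hmc hl hξ M
  have hnorm : ∀ t ∈ Icc a b, ∀ n, ‖mode k m ξ M n t‖
      = m t * rad k t * (expWeight (ξ * t) M n * ‖fCoeff (dev k t) n‖) := fun t ht n =>
    h.norm_mode (hs ht) (hm t ht).le ξ M n
  have hsumm : ∀ t ∈ Icc a b, Summable fun n => ‖mode k m ξ M n t‖ := fun t ht => by
    simp only [hnorm t ht]
    exact ((hW t ht).summable (h.smoothPer_dev (hs ht))).mul_left _
  have hts : ∀ t ∈ Icc a b, ∑' n, ‖mode k m ξ M n t‖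
      = m t * rad k t * wnorm (expWeight (ξ * t) M) (dev k t) := fun t ht => by
    simp only [hnorm t ht, tsum_mul_left, wnorm]
  have ma : a ∈ Icc a b := left_mem_Icc.2 hab
  have mb : b ∈ Icc a b := right_mem_Icc.2 hab
  rw [← hts a ma, ← hts b mb]
  refine tsum_norm_le_tsum_norm_of_dini (z := mode k m ξ M)
    (z' := fun n t => if n = 0 then 0 else ((m t * expWeight (ξ * t) M n : ℝ) : ℂ)
      * ((modeRate p k l ξ M n t : ℝ) * rho k n t + forcing p k n t))
    (h := modeBound p k m l ξ M) hab
    (fun n => h.continuousOn_mode hs hmc ξ M n) (fun n t ht => ?_)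
    (fun n => h.continuousOn_modeBound hs hmc hl ξ M n) (fun n t ht hz => ?_)
    (fun n t ht hz => ?_) hB hhB (fun t ht => ?_) (hsumm a ma) (hsumm b mb)
  · have ht' : t ∈ Icc a b := ⟨ht.1, ht.2.le⟩
    by_cases hn : n = 0
    · have e : mode k m ξ M n = fun _ => 0 := by
        funext s
        rw [mode, if_pos hn]
      rw [e, if_pos hn]
      exact hasDerivAt_const _ _
    · rw [if_neg hn]
      exact h.hasDerivAt_mode ⟨ha.trans_le ht.1, ht.2.trans hb⟩ (hml t ht') hp ξ M hn
  · have ht' : t ∈ Icc a b := ⟨ht.1, ht.2.le⟩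
    by_cases hn : n = 0
    · exact absurd (by rw [mode, if_pos hn]) hz
    · rw [if_neg hn, mode, if_neg hn, modeBound, if_neg hn]
      exact inner_mode_le (mul_nonneg (hm t ht').le (Real.exp_pos _).le) _ _
  · have ht' : t ∈ Icc a b := ⟨ht.1, ht.2.le⟩
    by_cases hn : n = 0
    · rw [if_pos hn, modeBound, if_pos hn, norm_zero]
    · rw [mode, if_neg hn] at hz
      have hc : 0 < m t * expWeight (ξ * t) M n := mul_pos (hm t ht') (Real.exp_pos _)
      have hz0 : rho k n t = 0 :=
        (mul_eq_zero.1 hz).resolve_left (by exact_mod_cast hc.ne')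
      rw [if_neg hn, modeBound, if_neg hn, hz0, norm_mul, Complex.norm_real, Real.norm_eq_abs,
        abs_of_pos hc]
      simp
  · have ht' : t ∈ Icc a b := ⟨ht.1.le, ht.2.le⟩
    have sd := h.smoothPer_dev (hs ht')
    have s1 := ((hW t ht').summable sd).mul_left (l t * rad k t ^ (p + 1) + 1)
    have s2 := ((hW t ht').summable2 sd).mul_left (ξ * rad k t ^ (p + 1) - 1)
    have s3 := ((hW t ht').summable2 (h.smoothPer_nonlin (hs ht'))).mul_left (1 / (p : ℝ))
    have sB : Summable fun n => modeBound p k m l ξ M n t :=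
      hB.of_norm_bounded fun n => hhB n t ht'
    refine (sB.tsum_le_tsum (fun n => h.modeBound_le hp (hs ht') (hm t ht').le l hξ M n)
      (((s1.add s2).add s3).mul_left _)).trans ?_
    rw [tsum_mul_left, (s1.add s2).tsum_add s3, s1.tsum_add s2, tsum_mul_left, tsum_mul_left,
      tsum_mul_left]
    have hR := h.rad_pos (hs ht')
    have hmt := hm t ht'
    exact mul_nonpos_of_nonneg_of_nonpos (by positivity) (hd t ht)

theorem continuousOn_wnorm_dev (h : CurvFlow p T k) {ξ : ℝ} (hξ : 0 ≤ ξ) (M : ℕ) :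
    ContinuousOn (fun t => wnorm (expWeight (ξ * t) M) (dev k t)) (Ico 0 T) := by
  have key : ∀ b < T, ContinuousOn (fun t => wnorm (expWeight (ξ * t) M) (dev k t)) (Icc 0 b) := by
    intro b hb
    have hs : Icc 0 b ⊆ Ico 0 T := Icc_subset_Ico_right hb
    obtain ⟨A, hA⟩ := isCompact_Icc.exists_bound_of_continuousOn
      ((h.continuousOn_inv_rad_pow 1).mono hs)
    obtain ⟨C, hC, dC⟩ := h.smooth_inv.exists_decay hb
    have e : ∀ t ∈ Icc 0 b, ∀ n, expWeight (ξ * t) M n * ‖fCoeff (dev k t) n‖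
        = (rad k t ^ 1)⁻¹ * ‖mode k (fun _ => 1) ξ M n t‖ := by
      intro t ht n
      have hR := h.rad_pos (hs ht)
      rw [h.norm_mode (hs ht) zero_le_one, pow_one, one_mul, inv_mul_cancel_left₀ hR.ne']
    have hc : ContinuousOn (fun t => ∑' n, (rad k t ^ 1)⁻¹ * ‖mode k (fun _ => 1) ξ M n t‖)
        (Icc 0 b) := by
      refine continuousOn_tsum (fun n => ((h.continuousOn_inv_rad_pow 1).mono hs).mul
        (h.continuousOn_mode hs continuousOn_const ξ M n).norm)
        (summable_int_quartic.mul_left (|A| * (Real.exp (ξ * b * M) * C))) fun n t ht => ?_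
      have b1 := (hA t ht).trans (le_abs_self _)
      rw [norm_mul, norm_norm]
      have b2 : ‖mode k (fun _ => 1) ξ M n t‖
          ≤ Real.exp (ξ * b * M) * C * ((1 + (n : ℝ) ^ 2) * (1 / (1 + (n : ℝ) ^ 4))) := by
        rw [mode]
        split_ifs
        · rw [norm_zero]; positivity
        · have bw : expWeight (ξ * t) M n ≤ Real.exp (ξ * b * M) := expWeight_le hξ ht.1 ht.2 M n
          have w0 : 0 ≤ expWeight (ξ * t) M n := (Real.exp_pos _).le
          have b3 : ‖rho k n t‖ ≤ C * (1 / (1 + (n : ℝ) ^ 4)) := dC t ht n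
          rw [one_mul, norm_mul, Complex.norm_real, Real.norm_eq_abs, abs_of_nonneg w0, mul_assoc]
          gcongr
          refine b3.trans ?_
          gcongr
          exact le_mul_of_one_le_left (by positivity) (by nlinarith [sq_nonneg (n : ℝ)])
      calc _ ≤ |A| * (Real.exp (ξ * b * M) * C * ((1 + (n : ℝ) ^ 2) * (1 / (1 + (n : ℝ) ^ 4)))) := by
            gcongr
        _ = _ := by ring
    refine hc.congr fun t ht => ?_
    simp only [wnorm, e t ht]
  intro t ht
  obtain ⟨b, h1, h2⟩ := exists_between ht.2
  refine (key b h2 t ⟨ht.1, h1.le⟩).mono_of_mem_nhdsWithin ?_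
  filter_upwards [self_mem_nhdsWithin, mem_nhdsWithin_of_mem_nhds (Iio_mem_nhds h1)] with s i j
  exact ⟨i.1, j.le⟩

end CurvFlow

/-! ### Decay of the deviation -/

namespace CurvFlow

variable {p : ℕ} {T : ℝ} {k : ℝ → ℝ → ℝ}

theorem wnorm_dev_le_initial (h : CurvFlow p T k) (hp : 1 ≤ p) {b : ℝ} (hb : b ∈ Ico 0 T)
    (q : ℕ) (K : ℝ) {ξ : ℝ} (hξ : 0 ≤ ξ) (M : ℕ)
    (hd : ∀ t ∈ Ioo 0 b,
      ((q - K * rad k t) * (rad k t ^ p * mspd p k t) / p + 1)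
        * wnorm (expWeight (ξ * t) M) (dev k t)
      + (ξ * rad k t ^ (p + 1) - 1) * wnorm2 (expWeight (ξ * t) M) (dev k t)
      + 1 / p * wnorm2 (expWeight (ξ * t) M) (nonlin p k t) ≤ 0) :
    Real.exp (K * rad k b) * (rad k b ^ q)⁻¹ * rad k b * wnorm (expWeight (ξ * b) M) (dev k b)
      ≤ Real.exp (K * rad k 0) * (rad k 0 ^ q)⁻¹ * rad k 0
        * wnorm (expWeight (ξ * 0) M) (dev k 0) := by
  rcases hb.1.eq_or_lt with rfl | hb0
  · exact le_rfl
  have hT : 0 < T := hb0.trans hb.2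
  have hp0 : (p : ℝ) ≠ 0 := by positivity
  set m : ℝ → ℝ := fun t => Real.exp (K * rad k t) * (rad k t ^ q)⁻¹ with hm
  set l : ℝ → ℝ := fun t => (q * (rad k t ^ 1)⁻¹ - K) * (mspd p k t / p) with hl
  have hmpos : ∀ t ∈ Ico 0 T, 0 < m t := fun t ht =>
    mul_pos (Real.exp_pos _) (inv_pos.2 (pow_pos (h.rad_pos ht) q))
  have hmc : ContinuousOn m (Ico 0 T) :=
    (Real.continuous_exp.comp_continuousOn (continuousOn_const.mul h.continuousOn_rad)).mul
      (h.continuousOn_inv_rad_pow q)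
  have hlc : ContinuousOn l (Ico 0 T) :=
    ((continuousOn_const.mul (h.continuousOn_inv_rad_pow 1)).sub continuousOn_const).mul
      (h.continuousOn_mspd.div_const _)
  have hml : ∀ t ∈ Ioo 0 T, HasDerivAt m (m t * l t) t := fun t ht => by
    have hR := h.rad_pos ⟨ht.1.le, ht.2⟩
    have d := h.hasDerivAt_rad ht
    have := ((d.const_mul K).exp).mul ((d.pow q).inv (pow_pos hR q).ne')
    refine this.congr_deriv ?_
    simp only [hm, hl, Pi.pow_apply, Pi.inv_apply]
    rcases q with _ | q
    · simp
    · rw [Nat.add_sub_cancel]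
      field_simp
      ring
  have hstep : ∀ a ∈ Ioo 0 b, m b * rad k b * wnorm (expWeight (ξ * b) M) (dev k b)
      ≤ m a * rad k a * wnorm (expWeight (ξ * a) M) (dev k a) := fun a ha => by
    have hs : Icc a b ⊆ Ioo 0 T := fun t ht => ⟨ha.1.trans_le ht.1, ht.2.trans_lt hb.2⟩
    have hs' : Icc a b ⊆ Ico 0 T := hs.trans Ioo_subset_Ico_self
    refine h.weighted_wnorm_le_of_pos hp ha.1 ha.2.le hb.2 (fun t ht => hmpos t (hs' ht))
      (hlc.mono hs') (fun t ht => hml t (hs ht)) hξ M fun t ht => ?_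
    have ht0 : t ∈ Ioo 0 b := ⟨ha.1.trans ht.1, ht.2⟩
    have hR := h.rad_pos (hs' ⟨ht.1.le, ht.2.le⟩)
    have e : l t * rad k t ^ (p + 1)
        = (q - K * rad k t) * (rad k t ^ p * mspd p k t) / p := by
      simp only [hl]
      field_simp
      ring
    rw [e]
    exact hd t ht0
  have hc : ContinuousWithinAt
      (fun a => m a * rad k a * wnorm (expWeight (ξ * a) M) (dev k a)) (Ioi 0) 0 :=
    (((hmc.mul h.continuousOn_rad).mul (h.continuousOn_wnorm_dev hξ M)) 0 ⟨le_rfl, hT⟩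
      ).mono_of_mem_nhdsWithin (mem_of_superset (Ioo_mem_nhdsGT hT) Ioo_subset_Ico_self)
  refine ge_of_tendsto hc ?_
  filter_upwards [Ioo_mem_nhdsGT hb0] with a ha
  exact hstep a ha

theorem exists_wnorm_dev_decay (hp : 1 ≤ p) : ∃ ε : ℝ, 0 < ε ∧ ε ≤ 1 / 8 ∧
    ∀ (T : ℝ) (k : ℝ → ℝ → ℝ), 0 < T → CurvFlow p T k → wnorm (fun _ => 1) (dev k 0) < ε →
      ∃ C ξ : ℝ, 0 < C ∧ 0 < ξ ∧ ∀ M : ℕ, ∀ t ∈ Ico 0 T,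
        wnorm (expWeight (ξ * t) M) (dev k t) ≤ 1 / 8 ∧
        wnorm (expWeight (ξ * t) M) (dev k t) * rad k t ≤ C * rad k t ^ (3 * p) ∧
        rad k t ^ p * mspd p k t ≤ 2 := by
  obtain ⟨C₁, hC₁, hrec⟩ := exists_reciprocal_power_bound p
  have hp1 : (1 : ℝ) ≤ p := by exact_mod_cast hp
  set ε : ℝ := 1 / (20 * (C₁ + 1)) with hε
  have hε0 : 0 < ε := by positivity
  have hε1 : ε * (C₁ + 1) = 1 / 20 := by rw [hε]; field_simp
  have hε2 : ε ≤ 1 / 20 := by nlinarith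
  have hε3 : C₁ * ε ≤ 1 / 20 := by nlinarith
  have hsq : ∀ N, 0 ≤ N → N ≤ ε → C₁ * N ^ 2 ≤ C₁ * N := fun N h0 h1 =>
    mul_le_mul_of_nonneg_left (pow_le_of_le_one h0 (by linarith) two_ne_zero) hC₁
  refine ⟨ε, hε0, by linarith, fun T k hT h h0 => ?_⟩
  have m0 : (0 : ℝ) ∈ Ico 0 T := ⟨le_rfl, hT⟩
  have hR0 := h.rad_pos m0
  have hRle : ∀ t ∈ Ico 0 T, rad k t ≤ rad k 0 := fun t ht => h.antitoneOn_rad m0 ht ht.1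
  set ξ : ℝ := 1 / (20 * rad k 0 ^ (p + 1)) with hξd
  have hξ : 0 < ξ := by positivity
  have hξR : ∀ t ∈ Ico 0 T, ξ * rad k t ^ (p + 1) ≤ 1 / 20 := fun t ht => by
    have hR := h.rad_pos ht
    have := hRle t ht
    calc ξ * rad k t ^ (p + 1) ≤ ξ * rad k 0 ^ (p + 1) := by gcongr
      _ = 1 / 20 := by rw [hξd]; field_simp
  have hw0 : ∀ M, expWeight (ξ * 0) M = fun _ => 1 := fun M => by
    funext n
    rw [mul_zero, expWeight_zero]
  have hW : ∀ M : ℕ, ∀ t ∈ Ico 0 T, IsWeight (expWeight (ξ * t) M) := fun M t ht =>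
    isWeight_expWeight (mul_nonneg hξ.le ht.1) M
  have hstat : ∀ M : ℕ, ∀ t ∈ Ico 0 T, wnorm (expWeight (ξ * t) M) (dev k t) ≤ ε →
      |rad k t ^ p * mspd p k t - 1| ≤ C₁ * wnorm (expWeight (ξ * t) M) (dev k t) ^ 2 ∧
      1 / p * wnorm2 (expWeight (ξ * t) M) (nonlin p k t)
        ≤ C₁ * wnorm (expWeight (ξ * t) M) (dev k t)
          * wnorm2 (expWeight (ξ * t) M) (dev k t) := fun M t ht hN => by
    obtain ⟨i1, i2⟩ := hrec _ _ _ (hW M t ht) (h.smoothPer_exc ht) (h.smoothPer_dev ht)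
      (h.exc_mul_dev ht) (by linarith)
    refine ⟨(h.abs_rad_pow_mul_mspd_sub_one_le ht (hW M t ht)).trans i1, ?_⟩
    have n2 := wnorm2_nonneg (hW M t ht) (nonlin p k t)
    calc 1 / p * wnorm2 (expWeight (ξ * t) M) (nonlin p k t)
        ≤ 1 * wnorm2 (expWeight (ξ * t) M) (nonlin p k t) := by
          gcongr
          rw [div_le_one (by linarith)]
          exact hp1
      _ ≤ _ := by rw [one_mul, mul_assoc]; exact i2
  have hlin : ∀ M : ℕ, ∀ b ∈ Ico 0 T,
      (∀ t ∈ Ioo 0 b, wnorm (expWeight (ξ * t) M) (dev k t) ≤ ε) →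
      wnorm (expWeight (ξ * b) M) (dev k b)
        ≤ wnorm (fun _ => 1) (dev k 0) / rad k 0 * rad k b := fun M b hb hN => by
    have hR := h.rad_pos hb
    have := h.wnorm_dev_le_initial hp hb 2 0 hξ.le M fun t ht => ?_
    · rw [hw0] at this
      simp only [zero_mul, Real.exp_zero, one_mul] at this
      have e : ∀ r : ℝ, 0 < r → (r ^ 2)⁻¹ * r = r⁻¹ := fun r hr => by field_simp
      rw [e _ hR, e _ hR0] at this
      rw [inv_mul_le_iff₀ hR] at this
      refine this.trans (le_of_eq ?_)
      ring
    · have ht' : t ∈ Ico 0 T := ⟨ht.1.le, ht.2.trans hb.2⟩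
      obtain ⟨s1, s2⟩ := hstat M t ht' (hN t ht)
      have f := h.four_mul_wnorm_dev_le ht' (hW M t ht')
      have x := hξR t ht'
      have hE := h.mspd_pos ht'
      have hRt := h.rad_pos ht'
      have n0 := wnorm_nonneg (hW M t ht') (dev k t)
      have nle := hN t ht
      set N := wnorm (expWeight (ξ * t) M) (dev k t)
      set N₂ := wnorm2 (expWeight (ξ * t) M) (dev k t)
      set E := rad k t ^ p * mspd p k t
      have hE0 : 0 ≤ E := by positivity
      have c1 : C₁ * N ≤ 1 / 20 := (mul_le_mul_of_nonneg_left nle hC₁).trans hε3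
      have c2 : C₁ * N ^ 2 ≤ 1 / 10 := by nlinarith
      have e1 : E ≤ 11 / 10 := by linarith [(abs_le.1 s1).2]
      have e2 : (((2 : ℕ) : ℝ) - 0 * rad k t) * E / p ≤ 2 * E := by
        rw [div_le_iff₀ (by linarith)]
        push_cast
        nlinarith
      have b1 := mul_le_mul_of_nonneg_right e2 n0
      have b2 := mul_le_mul_of_nonneg_right e1 n0
      have N20 : 0 ≤ N₂ := by linarith
      have b3 := mul_le_mul_of_nonneg_right x N20
      have b4 := mul_le_mul_of_nonneg_right c1 N20
      linarith
  have hsmall : ∀ M : ℕ, ∀ t ∈ Ico 0 T, wnorm (expWeight (ξ * t) M) (dev k t) < ε := by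
    intro M t₁ ht₁
    by_contra! hge
    have hs : Icc 0 t₁ ⊆ Ico 0 T := Icc_subset_Ico_right ht₁.2
    have hc := (h.continuousOn_wnorm_dev hξ.le M).mono hs
    have hcomp : IsCompact (Icc 0 t₁ ∩ (fun t => wnorm (expWeight (ξ * t) M) (dev k t)) ⁻¹' Ici ε) :=
      isCompact_Icc.of_isClosed_subset (hc.preimage_isClosed_of_isClosed isClosed_Icc isClosed_Ici)
        inter_subset_left
    obtain ⟨s, ⟨hs1, hs2⟩, hmin⟩ := hcomp.exists_isLeast ⟨t₁, ⟨ht₁.1, le_rfl⟩, hge⟩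
    have hsT := hs hs1
    have hb := hlin M s hsT fun t ht => by
      by_contra! hlt
      exact (hmin ⟨⟨ht.1.le, ht.2.le.trans hs1.2⟩, hlt.le⟩).not_gt ht.2
    have hRs := hRle s hsT
    have n0 := wnorm_nonneg (hW M 0 m0) (dev k 0)
    rw [hw0] at n0
    have : wnorm (fun _ => 1) (dev k 0) / rad k 0 * rad k s ≤ wnorm (fun _ => 1) (dev k 0) := by
      rw [div_mul_eq_mul_div, div_le_iff₀ hR0]
      gcongr
    have hs3 : ε ≤ wnorm (expWeight (ξ * s) M) (dev k s) := hs2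
    linarith
  set A : ℝ := wnorm (fun _ => 1) (dev k 0) / rad k 0 with hA
  have n00 : 0 ≤ wnorm (fun _ => 1) (dev k 0) := by
    have n0 := wnorm_nonneg (hW 0 0 m0) (dev k 0)
    rwa [hw0] at n0
  have hA0 : 0 ≤ A := div_nonneg n00 hR0.le
  set K : ℝ := 2 * p * (7 * C₁ * A + 4 * ξ * rad k 0 ^ p) with hK
  have hK0 : 0 ≤ K := by positivity
  refine ⟨Real.exp (K * rad k 0) * (rad k 0 ^ (3 * p))⁻¹ * rad k 0
    * wnorm (fun _ => 1) (dev k 0) + 1, ξ, by positivity, hξ, fun M b hb => ⟨?_, ?_, ?_⟩⟩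
  · linarith [hsmall M b hb]
  · have hR := h.rad_pos hb
    have := h.wnorm_dev_le_initial hp hb (3 * p) K hξ.le M fun t ht => ?_
    · rw [hw0] at this
      have n0 := wnorm_nonneg (hW M b hb) (dev k b)
      have i1 : (rad k b ^ (3 * p))⁻¹ * (wnorm (expWeight (ξ * b) M) (dev k b) * rad k b)
          ≤ Real.exp (K * rad k b) * (rad k b ^ (3 * p))⁻¹ * rad k b
            * wnorm (expWeight (ξ * b) M) (dev k b) := by
        have := mul_le_mul_of_nonneg_right (Real.one_le_exp (mul_nonneg hK0 hR.le))
          (show 0 ≤ (rad k b ^ (3 * p))⁻¹ * (wnorm (expWeight (ξ * b) M) (dev k b) * rad k b) by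
            positivity)
        linarith
      have i2 := i1.trans this
      rw [inv_mul_le_iff₀ (by positivity)] at i2
      refine i2.trans ?_
      rw [mul_comm]
      gcongr
      linarith
    · have ht' : t ∈ Ico 0 T := ⟨ht.1.le, ht.2.trans hb.2⟩
      have nle := (hsmall M t ht').le
      obtain ⟨s1, s2⟩ := hstat M t ht' nle
      have f := h.four_mul_wnorm_dev_le ht' (hW M t ht')
      have x := hξR t ht'
      have hE := h.mspd_pos ht'
      have hRt := h.rad_pos ht'
      have n0 := wnorm_nonneg (hW M t ht') (dev k t)
      have nA := hlin M t ht' fun s hs => (hsmall M s ⟨hs.1.le, hs.2.trans ht'.2⟩).le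
      have hξ2 : ξ * rad k t ^ (p + 1) ≤ ξ * rad k 0 ^ p * rad k t := by
        have := hRle t ht'
        rw [pow_succ, ← mul_assoc]
        gcongr
      set N := wnorm (expWeight (ξ * t) M) (dev k t)
      set N₂ := wnorm2 (expWeight (ξ * t) M) (dev k t)
      set E := rad k t ^ p * mspd p k t
      set R := rad k t
      set X := ξ * R ^ (p + 1)
      have c1 : C₁ * N ≤ 1 / 20 := (mul_le_mul_of_nonneg_left nle hC₁).trans hε3
      have c2 : C₁ * N ^ 2 ≤ C₁ * N := hsq N n0 nle
      have c3 : C₁ * N ≤ C₁ * (A * R) := mul_le_mul_of_nonneg_left nA hC₁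
      have e1 : E ≤ 1 + C₁ * N := by linarith [(abs_le.1 s1).2]
      have e3 : 1 / 2 ≤ E := by linarith [(abs_le.1 s1).1]
      have e2 : (((3 * p : ℕ) : ℝ) - K * R) * E / p = 3 * E - 2 * E * (7 * C₁ * A * R
          + 4 * (ξ * rad k 0 ^ p * R)) := by
        rw [hK]
        push_cast
        field_simp
      have e4 : 7 * C₁ * A * R + 4 * (ξ * rad k 0 ^ p * R) ≤ 2 * E * (7 * C₁ * A * R
          + 4 * (ξ * rad k 0 ^ p * R)) :=
        le_mul_of_one_le_left (by positivity) (by linarith)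
      have N20 : 0 ≤ N₂ := by linarith
      have b1 : (3 * E - 2 * E * (7 * C₁ * A * R + 4 * (ξ * rad k 0 ^ p * R)) + 1
          + 4 * (X - 1 + C₁ * N)) * N ≤ 0 :=
        mul_nonpos_of_nonpos_of_nonneg (by linarith) n0
      have b2 : (X - 1 + C₁ * N) * (N₂ - 4 * N) ≤ 0 :=
        mul_nonpos_of_nonpos_of_nonneg (by linarith) (by linarith)
      rw [e2]
      linarith
  · have s := (hstat M b hb (hsmall M b hb).le).1
    have n0 := wnorm_nonneg (hW M b hb) (dev k b)
    have nle := (hsmall M b hb).le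
    have c1 := mul_le_mul_of_nonneg_left nle hC₁
    have : C₁ * wnorm (expWeight (ξ * b) M) (dev k b) ^ 2
        ≤ C₁ * wnorm (expWeight (ξ * b) M) (dev k b) := hsq _ n0 nle
    linarith [(abs_le.1 s).2]

end CurvFlow

/-! ### The initial deviation -/

theorem sq_mul_norm_fCoeff_le_seminorm2 {f : ℝ → ℝ} (hf : SmoothPer f) (n : ℤ) :
    (n : ℝ) ^ 2 * ‖fCoeff f n‖ ≤ 2 * seminorm2 f := by
  obtain ⟨C, hC, h⟩ := hf.exists_decay
  have hb : ∀ m : ℤ, (m : ℝ) ^ 2 * ‖fCoeff f m‖ ≤ C := fun m => by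
    calc (m : ℝ) ^ 2 * ‖fCoeff f m‖ ≤ (m : ℝ) ^ 2 * (C * (1 / (1 + (m : ℝ) ^ 4))) := by
          gcongr
          exact h m
      _ = C * ((m : ℝ) ^ 2 / (1 + (m : ℝ) ^ 4)) := by ring
      _ ≤ C * 1 := by
          gcongr
          rw [div_le_one (by positivity)]
          nlinarith [sq_nonneg ((m : ℝ) ^ 2 - 1)]
      _ = C := mul_one C
  have b1 : BddAbove (range fun m : ℤ => (m : ℝ) ^ 2 * |(fCoeff f m).re|) := by
    refine ⟨C, ?_⟩
    rintro _ ⟨m, rfl⟩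
    exact (mul_le_mul_of_nonneg_left (Complex.abs_re_le_norm _) (sq_nonneg _)).trans (hb m)
  have b2 : BddAbove (range fun m : ℤ => (m : ℝ) ^ 2 * |(fCoeff f m).im|) := by
    refine ⟨C, ?_⟩
    rintro _ ⟨m, rfl⟩
    exact (mul_le_mul_of_nonneg_left (Complex.abs_im_le_norm _) (sq_nonneg _)).trans (hb m)
  have h1 := (le_ciSup b1 n).trans (le_max_left _ (⨆ m : ℤ, (m : ℝ) ^ 2 * |(fCoeff f m).im|))
  have h2 := (le_ciSup b2 n).trans (le_max_right (⨆ m : ℤ, (m : ℝ) ^ 2 * |(fCoeff f m).re|) _)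
  have h3 := mul_le_mul_of_nonneg_left (Complex.norm_le_abs_re_add_abs_im (fCoeff f n))
    (sq_nonneg (n : ℝ))
  unfold seminorm2
  linarith

theorem isWeight_one : IsWeight fun _ => 1 :=
  ⟨fun _ => le_rfl, fun _ _ => by norm_num, ⟨1, fun _ => le_rfl⟩⟩

theorem summable_int_inv_sq : Summable fun n : ℤ => 1 / (n : ℝ) ^ 2 :=
  Real.summable_one_div_int_pow.2 one_lt_two

theorem wnorm_normalized_le {f : ℝ → ℝ} (hf : SmoothPer f) (h0 : 0 < (fCoeff f 0).re) :
    wnorm (fun _ => 1) (fun x => (fCoeff f 0).re⁻¹ * f x - 1)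
      ≤ (fCoeff f 0).re⁻¹ * (2 * seminorm2 f) * ∑' n : ℤ, 1 / (n : ℝ) ^ 2 := by
  have s := (hf.const_mul (fCoeff f 0).re⁻¹).sub (.const 1)
  unfold wnorm
  rw [← tsum_mul_left]
  refine (isWeight_one.summable s).tsum_le_tsum (fun n => ?_) (summable_int_inv_sq.mul_left _)
  rw [fCoeff_sub (f := fun x => (fCoeff f 0).re⁻¹ * f x) (g := fun _ => 1)
    (hf.const_mul _).continuous continuous_const, fCoeff_const_mul, fCoeff_one, one_mul]
  by_cases hn : n = 0
  · subst hn
    rw [if_pos rfl, ← ofReal_fCoeff_zero_re, ← Complex.ofReal_mul, Complex.ofReal_re,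
      inv_mul_cancel₀ h0.ne']
    simp
  · have n0 : (0 : ℝ) < (n : ℝ) ^ 2 := by positivity
    rw [if_neg hn, sub_zero, norm_mul, Complex.norm_real, Real.norm_eq_abs, abs_inv,
      abs_of_pos h0, mul_assoc, mul_one_div]
    gcongr
    rw [le_div_iff₀ n0, mul_comm]
    exact sq_mul_norm_fCoeff_le_seminorm2 hf n

theorem wnorm_normalized_inv_le {f : ℝ → ℝ} (hf : SmoothPer f) (hpos : ∀ x, 0 < f x)
    (hs : wnorm (fun _ => 1) (fun x => (fCoeff f 0).re⁻¹ * f x - 1) ≤ 1 / 8) :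
    wnorm (fun _ => 1) (fun x => (fCoeff (fun y => (f y)⁻¹) 0).re⁻¹ * (f x)⁻¹ - 1)
      ≤ 4 * wnorm (fun _ => 1) (fun x => (fCoeff f 0).re⁻¹ * f x - 1) := by
  have ha := fCoeff_zero_re_pos hf.continuous hpos
  set a := (fCoeff f 0).re with had
  have hi : SmoothPer fun x => (f x)⁻¹ :=
    ⟨hf.smooth.inv fun x => (hpos x).ne', fun x => by rw [hf.per x]⟩
  have hr := fCoeff_zero_re_pos hi.continuous fun x => inv_pos.2 (hpos x)
  set r := (fCoeff (fun y => (f y)⁻¹) 0).re with hrd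
  have su : SmoothPer fun x => a⁻¹ * f x - 1 := (hf.const_mul _).sub (.const 1)
  have sv : SmoothPer fun x => a * (f x)⁻¹ - 1 := (hi.const_mul _).sub (.const 1)
  have sd : SmoothPer fun x => r⁻¹ * (f x)⁻¹ - 1 := (hi.const_mul _).sub (.const 1)
  have hv := (wnorm_reciprocal_le isWeight_one sv su (fun x => by
    have := (hpos x).ne'
    field_simp
    ring) hs).1
  have cd : ∀ (c : ℝ) (n : ℤ), fCoeff (fun x => c * (f x)⁻¹ - 1) n
      = c * fCoeff (fun y => (f y)⁻¹) n - if n = 0 then 1 else 0 := fun c n => by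
    rw [fCoeff_sub (f := fun x => c * (f x)⁻¹) (g := fun _ => 1)
      (hi.const_mul _).continuous continuous_const, fCoeff_const_mul, fCoeff_one]
  have e0 : fCoeff (fun y => (f y)⁻¹) 0 = (r : ℂ) := (ofReal_fCoeff_zero_re _).symm
  have har : 1 / 2 ≤ a * r := by
    have := (norm_fCoeff_le_wnorm isWeight_one sv 0).trans hv
    rw [cd, if_pos rfl, e0, ← Complex.ofReal_mul, ← Complex.ofReal_one, ← Complex.ofReal_sub,
      Complex.norm_real, Real.norm_eq_abs] at this
    linarith [(abs_le.1 this).1]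
  have hle : wnorm (fun _ => 1) (fun x => r⁻¹ * (f x)⁻¹ - 1)
      ≤ 2 * wnorm (fun _ => 1) (fun x => a * (f x)⁻¹ - 1) := by
    unfold wnorm
    rw [← tsum_mul_left]
    refine (isWeight_one.summable sd).tsum_le_tsum (fun n => ?_)
      ((isWeight_one.summable sv).mul_left 2)
    rw [cd, cd, one_mul, one_mul]
    by_cases hn : n = 0
    · subst hn
      rw [if_pos rfl, e0, ← Complex.ofReal_mul, inv_mul_cancel₀ hr.ne', Complex.ofReal_one,
        sub_self, norm_zero]
      positivity
    · rw [if_neg hn, sub_zero, sub_zero, norm_mul, norm_mul, Complex.norm_real, Complex.norm_real,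
        Real.norm_eq_abs, Real.norm_eq_abs, abs_inv, abs_of_pos hr, abs_of_pos ha, ← mul_assoc]
      gcongr
      rw [inv_le_iff_one_le_mul₀ hr]
      linarith
  linarith

/-! ### Extinction of the mean radius -/

namespace CurvFlow

variable {p : ℕ} {T : ℝ} {k : ℝ → ℝ → ℝ}

theorem rad_pow_add_monotoneOn (h : CurvFlow p T k) (hp : 1 ≤ p)
    (hE : ∀ t ∈ Ico 0 T, rad k t ^ p * mspd p k t ≤ 2) :
    MonotoneOn (fun t => rad k t ^ (p + 1) + 4 * t) (Ico 0 T) := by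
  have hp1 : (1 : ℝ) ≤ p := by exact_mod_cast hp
  have hd : ∀ t ∈ Ioo 0 T, HasDerivAt (fun t => rad k t ^ (p + 1) + 4 * t)
      (((p + 1 : ℕ) : ℝ) * rad k t ^ p * (-(mspd p k t / p)) + 4 * 1) t := fun t ht =>
    ((h.hasDerivAt_rad ht).pow (p + 1)).add ((hasDerivAt_id t).const_mul 4)
  refine monotoneOn_of_deriv_nonneg (convex_Ico 0 T)
    ((h.continuousOn_rad.pow _).add (by fun_prop)) ?_ ?_ <;>
    rw [interior_Ico] <;> intro t ht
  · exact (hd t ht).differentiableAt.differentiableWithinAt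
  · rw [(hd t ht).deriv]
    have ht' : t ∈ Ico 0 T := ⟨ht.1.le, ht.2⟩
    have := hE t ht'
    have h1 := h.mspd_pos ht'
    have h2 := h.rad_pos ht'
    have : ((p + 1 : ℕ) : ℝ) * rad k t ^ p * (mspd p k t / p) ≤ 4 := by
      calc ((p + 1 : ℕ) : ℝ) * rad k t ^ p * (mspd p k t / p)
          = (((p + 1 : ℕ) : ℝ) / p) * (rad k t ^ p * mspd p k t) := by ring
        _ ≤ 2 * 2 := by
            gcongr
            rw [div_le_iff₀ (by linarith)]
            push_cast
            linarith
        _ = 4 := by norm_num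
    linarith

theorem rad_pow_le (h : CurvFlow p T k) (hp : 1 ≤ p) (hT : 0 < T)
    (hE : ∀ t ∈ Ico 0 T, rad k t ^ p * mspd p k t ≤ 2)
    (hk : ∀ t ∈ Ico 0 T, ∀ x, rad k t * k x t ≤ 2)
    (hblow : Tendsto (fun t => ⨆ θ : Set.Icc (0:ℝ) (2 * Real.pi), k (θ : ℝ) t)
      (nhdsWithin T (Set.Iio T)) atTop) {t : ℝ} (ht : t ∈ Ico 0 T) :
    rad k t ^ (p + 1) ≤ 4 * (T - t) := by
  have hpi : (0 : ℝ) ∈ Icc (0 : ℝ) (2 * Real.pi) := ⟨le_rfl, by positivity⟩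
  have : Nonempty (Set.Icc (0:ℝ) (2 * Real.pi)) := ⟨⟨0, hpi⟩⟩
  have hlim : Tendsto (rad k) (nhdsWithin T (Iio T)) (nhds 0) := by
    refine squeeze_zero' ?_ ?_ (hblow.const_div_atTop 2)
    · filter_upwards [Ioo_mem_nhdsLT hT] with s hs
      exact (h.rad_pos ⟨hs.1.le, hs.2⟩).le
    · filter_upwards [Ioo_mem_nhdsLT hT, hblow.eventually_gt_atTop 0] with s hs h0
      have hs' : s ∈ Ico 0 T := ⟨hs.1.le, hs.2⟩
      have hR := h.rad_pos hs'
      rw [le_div_iff₀ h0, mul_comm, ← le_div_iff₀ hR]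
      refine ciSup_le fun θ => ?_
      rw [le_div_iff₀ hR, mul_comm]
      exact hk s hs' θ
  have hlim2 : Tendsto (fun s => rad k s ^ (p + 1) + 4 * s) (nhdsWithin T (Iio T))
      (nhds (0 ^ (p + 1) + 4 * T)) :=
    (hlim.pow _).add ((tendsto_id.mono_left nhdsWithin_le_nhds).const_mul 4)
  have := ge_of_tendsto hlim2 (b := rad k t ^ (p + 1) + 4 * t) (by
    filter_upwards [Ioo_mem_nhdsLT ht.2] with s hs
    exact h.rad_pow_add_monotoneOn hp hE ht ⟨ht.1.trans hs.1.le, hs.2⟩ hs.1.le)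
  rw [zero_pow (by omega)] at this
  linarith

theorem fCoeff_exc (h : CurvFlow p T k) {t : ℝ} (ht : t ∈ Ico 0 T) {n : ℤ} (hn : n ≠ 0) :
    fCoeff (exc k t) n = (rad k t : ℂ) * fCoeff (fun x => k x t) n := by
  have s := h.smooth.slice ht
  have := fCoeff_sub (f := fun x => rad k t * k x t) (g := fun _ => 1)
    (s.const_mul _).continuous continuous_const n
  unfold exc
  rw [this, fCoeff_const_mul, fCoeff_one, if_neg hn, sub_zero]

theorem weight_mul_norm_fCoeff_le (h : CurvFlow p T k) {t : ℝ} (ht : t ∈ Ico 0 T) {ω : ℤ → ℝ}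
    (hω : IsWeight ω) (hs : wnorm ω (dev k t) ≤ 1 / 8) {n : ℤ} (hn : n ≠ 0) :
    ω n * (rad k t * ‖fCoeff (fun x => k x t) n‖) ≤ 2 * wnorm ω (dev k t) := by
  have hR := h.rad_pos ht
  have := (weight_mul_norm_fCoeff_le_wnorm hω (h.smoothPer_exc ht) n).trans
    (wnorm_reciprocal_le hω (h.smoothPer_exc ht) (h.smoothPer_dev ht) (h.exc_mul_dev ht) hs).1
  rwa [h.fCoeff_exc ht hn, norm_mul, Complex.norm_real, Real.norm_eq_abs, abs_of_pos hR] at this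

theorem rad_mul_le_two (h : CurvFlow p T k) {t : ℝ} (ht : t ∈ Ico 0 T) {ω : ℤ → ℝ}
    (hω : IsWeight ω) (hs : wnorm ω (dev k t) ≤ 1 / 8) (x : ℝ) : rad k t * k x t ≤ 2 := by
  have h1 := (abs_le_wnorm hω (h.smoothPer_exc ht) x).trans
    (wnorm_reciprocal_le hω (h.smoothPer_exc ht) (h.smoothPer_dev ht) (h.exc_mul_dev ht) hs).1
  have h2 := (abs_le.1 h1).2
  unfold exc at h2
  linarith

end CurvFlow

/-- There is `c_p > 0` depending only on `p` such that if `ψ̂(0) ≥ c_p ‖ψ‖₂`,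
then there are `D, ξ > 0` with `|k̂(n,t)| ≤ D e^{-ξ|n|}(T-t)^{(3p-2)/(p+1)}` for all `|n| ≥ 2`
and all `t ∈ (T/2,T)`. -/
theorem statement10 (p : ℕ) (hp : 1 ≤ p) :
    ∃ cp > (0:ℝ), ∀ (T : ℝ), 0 < T → ∀ (k : ℝ → ℝ → ℝ) (ψ : ℝ → ℝ),
      IsPCSF p T k ψ →
      cp * seminorm2 ψ ≤ (fCoeff ψ 0).re →
      ∃ D > (0:ℝ), ∃ ξ > (0:ℝ), ∀ n : ℤ, 2 ≤ |n| →
        ∀ t : ℝ, T / 2 < t → t < T →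
          ‖fCoeff (fun θ => k θ t) n‖
            ≤ D * Real.exp (-ξ * |(n : ℝ)|)
              * (T - t) ^ ((3 * (p : ℝ) - 2) / ((p : ℝ) + 1)) := by
  obtain ⟨ε, hε, hε8, hdecay⟩ := CurvFlow.exists_wnorm_dev_decay hp
  have hZ : 0 ≤ ∑' n : ℤ, 1 / (n : ℝ) ^ 2 := tsum_nonneg fun n => by positivity
  refine ⟨16 * (∑' n : ℤ, 1 / (n : ℝ) ^ 2 + 1) / ε, by positivity,
    fun T hT k ψ hk hψ => ?_⟩
  have h := hk.curvFlow hp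
  obtain ⟨-, -, -, -, hinit, sψ, pψ, perψ, hblow, -⟩ := hk
  have hψs : SmoothPer ψ := ⟨sψ, perψ⟩
  have ha := fCoeff_zero_re_pos hψs.continuous pψ
  have hS : 0 ≤ seminorm2 ψ := by
    have := sq_mul_norm_fCoeff_le_seminorm2 hψs 0
    norm_num at this
    exact this
  have hu : wnorm (fun _ => 1) (fun x => (fCoeff ψ 0).re⁻¹ * ψ x - 1) ≤ ε / 8 := by
    refine (wnorm_normalized_le hψs ha).trans ?_
    rw [mul_assoc, inv_mul_le_iff₀ ha]
    rw [div_mul_eq_mul_div, div_le_iff₀ hε] at hψ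
    linarith
  have hdev : CurvFlow.dev k 0 = fun x => (fCoeff (fun y => (ψ y)⁻¹) 0).re⁻¹ * (ψ x)⁻¹ - 1 := by
    funext x
    simp only [CurvFlow.dev, CurvFlow.rad, CurvFlow.rho, hinit]
  obtain ⟨C, ξ, hC, hξ, hN⟩ := hdecay T k hT h (by
    rw [hdev]
    have := wnorm_normalized_inv_le hψs pψ (by linarith)
    linarith)
  have hp1 : (1 : ℝ) ≤ p := by exact_mod_cast hp
  have hrad : ∀ t ∈ Ico 0 T, CurvFlow.rad k t ^ (p + 1) ≤ 4 * (T - t) := fun t ht =>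
    h.rad_pow_le hp hT (fun s hs => (hN 0 s hs).2.2)
      (fun s hs => h.rad_mul_le_two hs (isWeight_expWeight (mul_nonneg hξ.le hs.1) 0)
        (hN 0 s hs).1) hblow ht
  set α : ℝ := (3 * (p : ℝ) - 2) / ((p : ℝ) + 1) with hα
  have hα0 : 0 ≤ α := div_nonneg (by linarith) (by linarith)
  refine ⟨2 * C * 4 ^ α, by positivity, ξ * T / 2, by positivity, fun n hn t ht1 ht2 => ?_⟩
  have ht : t ∈ Ico 0 T := ⟨by linarith, ht2⟩
  have hR := h.rad_pos ht
  have hn0 : n ≠ 0 := by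
    rintro rfl
    norm_num at hn
  obtain ⟨n1, n2, -⟩ := hN n.natAbs t ht
  have hk1 := h.weight_mul_norm_fCoeff_le ht
    (isWeight_expWeight (mul_nonneg hξ.le ht.1) n.natAbs) n1 hn0
  have hpow : CurvFlow.rad k t ^ (3 * p - 2) ≤ 4 ^ α * (T - t) ^ α := by
    rw [← Real.mul_rpow (by norm_num) (by linarith)]
    calc CurvFlow.rad k t ^ (3 * p - 2) = (CurvFlow.rad k t ^ (p + 1)) ^ α := by
          rw [← Real.rpow_natCast, ← Real.rpow_natCast, ← Real.rpow_mul hR.le, hα]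
          congr 1
          rw [Nat.cast_sub (by omega)]
          push_cast
          field_simp
      _ ≤ (4 * (T - t)) ^ α := Real.rpow_le_rpow (by positivity) (hrad t ht) hα0
  have hw : Real.exp (ξ * T / 2 * |(n : ℝ)|) ≤ expWeight (ξ * t) n.natAbs n := by
    unfold expWeight
    rw [Nat.cast_natAbs, Int.cast_abs, min_self]
    gcongr
    nlinarith
  have hfin : Real.exp (ξ * T / 2 * |(n : ℝ)|) * ‖fCoeff (fun θ => k θ t) n‖
      ≤ 2 * C * CurvFlow.rad k t ^ (3 * p - 2) := by
    have e : CurvFlow.rad k t ^ (3 * p)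
        = CurvFlow.rad k t ^ (3 * p - 2) * CurvFlow.rad k t ^ 2 := by
      rw [← pow_add]
      congr 1
      omega
    have k1 := mul_le_mul_of_nonneg_right hw (norm_nonneg (fCoeff (fun θ => k θ t) n))
    have k2 := mul_le_mul_of_nonneg_right hk1 hR.le
    rw [e] at n2
    refine k1.trans (le_of_mul_le_mul_right (a := CurvFlow.rad k t ^ 2) ?_ (by positivity))
    linarith
  have hneg : Real.exp (-(ξ * T / 2) * |(n : ℝ)|) = (Real.exp (ξ * T / 2 * |(n : ℝ)|))⁻¹ := by
    rw [← Real.exp_neg, neg_mul]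
  rw [hneg, mul_right_comm, ← div_eq_mul_inv, le_div_iff₀ (Real.exp_pos _), mul_comm]
  refine hfin.trans ?_
  rw [mul_assoc (2 * C)]
  gcongr
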